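/- arXiv:1009.2931 — 2 statements merged into one kernel-verified Lean document; each statement's English description precedes it below -/
import Mathlib

section
/- Let ℓ ≥ 2 be an even integer and n ≥ 2 an integer. Then the dimension over ℂ of the degree-n homogeneous component of the quotient ring ℂ[x_0,…,x_ℓ]/J equals Σ_{i=0}^{⌊nℓ/4⌋} (nℓ + 1 − 4i). (This is the dimension count for the Poisson closure of the symmetric algebra of the simple sl₂(ℂ)-module V_ℓ, ℓ even, corresponding to the decomposition S^n_σ V_ℓ ≅ ⊕_{i=0}^{⌊nℓ/4⌋} V_{nℓ−4i} of the paper's Main Theorem.) -/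
open MvPolynomial

/-- The derivation `E` on `ℂ[x_0,…,x_ℓ]` with `E(x_i) = i·x_{i−1}` (and `x_{−1} = 0`;
the `Fin` subtraction `i - 1` wraps around at `i = 0`, but there the coefficient vanishes). -/
noncomputable def Ederiv (ℓ : ℕ) :
    Derivation ℂ (MvPolynomial (Fin (ℓ + 1)) ℂ) (MvPolynomial (Fin (ℓ + 1)) ℂ) :=
  MvPolynomial.mkDerivation ℂ fun i => C ((i : ℕ) : ℂ) * X (i - 1)

/-- The derivation `F` with `F(x_i) = (ℓ−i)·x_{i+1}` (and `x_{ℓ+1} = 0`). -/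
noncomputable def Fderiv (ℓ : ℕ) :
    Derivation ℂ (MvPolynomial (Fin (ℓ + 1)) ℂ) (MvPolynomial (Fin (ℓ + 1)) ℂ) :=
  MvPolynomial.mkDerivation ℂ fun i => C ((ℓ : ℂ) - ((i : ℕ) : ℂ)) * X (i + 1)

/-- The derivation `H` with `H(x_i) = (ℓ−2i)·x_i`. -/
noncomputable def Hderiv (ℓ : ℕ) :
    Derivation ℂ (MvPolynomial (Fin (ℓ + 1)) ℂ) (MvPolynomial (Fin (ℓ + 1)) ℂ) :=
  MvPolynomial.mkDerivation ℂ fun i => C ((ℓ : ℂ) - 2 * ((i : ℕ) : ℂ)) * X i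

/-- `P_{abc}`, the image of `x_a ∧ x_b ∧ x_c` under the Jacobian map `E ∧ F ∧ H`. -/
noncomputable def Pabc (ℓ : ℕ) (a b c : Fin (ℓ + 1)) : MvPolynomial (Fin (ℓ + 1)) ℂ :=
  Matrix.det !![Ederiv ℓ (X a), Fderiv ℓ (X a), Hderiv ℓ (X a);
                Ederiv ℓ (X b), Fderiv ℓ (X b), Hderiv ℓ (X b);
                Ederiv ℓ (X c), Fderiv ℓ (X c), Hderiv ℓ (X c)]

/-- The Jacobian ideal `J`, generated by all `P_{abc}` with `a < b < c`. -/
noncomputable def Jideal (ℓ : ℕ) : Ideal (MvPolynomial (Fin (ℓ + 1)) ℂ) :=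
  Ideal.span {p | ∃ a b c : Fin (ℓ + 1), a < b ∧ b < c ∧ p = Pabc ℓ a b c}

theorem finrank_homogeneousSubmodule (k n : ℕ) :
    Module.finrank ℂ (homogeneousSubmodule (Fin k) ℂ n) = Nat.multichoose k n := by
  classical
  have hspan : homogeneousSubmodule (Fin k) ℂ n = Submodule.span ℂ
      (Set.range fun P : {P : Fin k →₀ ℕ // P.sum (fun _ ↦ id) = n} ↦
        (monomial P.1 (1 : ℂ) : MvPolynomial (Fin k) ℂ)) := by
    rw [homogeneousSubmodule_eq_finsupp_supported, AddMonoidAlgebra.supported_eq_span_single]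
    congr 1
    ext p
    simp only [Set.mem_image, Set.mem_ofPred_eq, Set.mem_range, Subtype.exists, exists_prop]
    rfl
  let _ : Fintype {P : Fin k →₀ ℕ // P.sum (fun _ ↦ id) = n} :=
    Fintype.ofEquiv _ (Sym.equivNatSum (Fin k) n)
  have hli : LinearIndependent ℂ
      (fun P : {P : Fin k →₀ ℕ // P.sum (fun _ ↦ id) = n} ↦
        (monomial P.1 (1 : ℂ) : MvPolynomial (Fin k) ℂ)) := by
    have := (basisMonomials (Fin k) ℂ).linearIndependent.comp
      (Subtype.val : {P : Fin k →₀ ℕ // P.sum (fun _ ↦ id) = n} → _) Subtype.val_injective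
    rw [coe_basisMonomials] at this
    exact this
  rw [hspan, finrank_span_eq_card hli, ← Fintype.card_congr (Sym.equivNatSum (Fin k) n),
    Sym.card_sym_eq_multichoose, Fintype.card_fin]

theorem sum_range_dims (K : ℕ) :
    ∑ i ∈ Finset.range (2 * K / 4 + 1), (2 * K + 1 - 4 * i) = Nat.multichoose 3 K := by
  have hstep (K : ℕ) : Nat.multichoose 3 (K + 2) = 2 * K + 5 + Nat.multichoose 3 K := by
    have h3 (j : ℕ) : Nat.multichoose 3 (j + 1) = (j + 2) + Nat.multichoose 3 j := by
      rw [Nat.multichoose_succ_succ, Nat.multichoose_two]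
    rw [h3, h3]
    ring
  induction K using Nat.twoStepInduction with
  | zero => simp
  | one => simp
  | more K ih _ =>
    rw [hstep, ← ih, show 2 * (K + 2) / 4 + 1 = (2 * K / 4 + 1) + 1 by omega,
      Finset.sum_range_succ', add_comm]
    congr 1
    refine Finset.sum_congr rfl fun i _ ↦ ?_
    omega

theorem multichoose_two_eq_multichoose_three (k : ℕ) :
    Nat.multichoose (k + 1) 2 = Nat.multichoose 3 k := by
  rw [Nat.multichoose_eq, Nat.multichoose_eq, show k + 1 + 2 - 1 = 2 + k by omega,
    show 3 + k - 1 = 2 + k by omega, Nat.choose_symm_add]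

theorem two_mul_multichoose_three (K : ℕ) :
    2 * Nat.multichoose 3 K = (K + 1) * (K + 2) := by
  induction K with
  | zero => simp
  | succ K ih =>
    rw [Nat.multichoose_succ_succ, Nat.multichoose_two, mul_add, ih]
    ring

/-- The number of standard monomials divisible by `x_r` but by no earlier variable. -/
def standardCount (m d r : ℕ) : ℕ := if r ≤ m then d * m + 1 else 2 * m + 1 - r

theorem multichoose_add_sum_standardCount (m d : ℕ) :
    Nat.multichoose 3 (d * m) + ∑ r ∈ Finset.Icc 1 (2 * m), standardCount m d r =
      Nat.multichoose 3 ((d + 1) * m) := by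
  have hlow : ∀ j ≤ m, ∑ r ∈ Finset.Icc 1 j, standardCount m d r = j * (d * m + 1) := by
    intro j hj
    rw [Finset.sum_congr rfl (g := fun _ ↦ d * m + 1)]
    · simp
    · intro r hr
      rw [Finset.mem_Icc] at hr
      exact if_pos (by omega)
  have hhigh : ∀ j ≤ m, 2 * ∑ r ∈ Finset.Icc 1 (m + j), standardCount m d r + j * j =
      2 * (m * (d * m + 1)) + j * (2 * m + 1) := by
    intro j
    induction j with
    | zero => intro _; simp [hlow m le_rfl]
    | succ j ih =>
      intro hj
      have := ih (by omega)
      rw [← add_assoc, Finset.sum_Icc_succ_top (by omega), standardCount, if_neg (by omega)]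
      obtain ⟨t, rfl⟩ : ∃ t, m = j + 1 + t := ⟨m - (j + 1), by omega⟩
      rw [show 2 * (j + 1 + t) + 1 - (j + 1 + t + j + 1) = t + 1 by omega]
      linarith
  have h := hhigh m le_rfl
  rw [← two_mul] at h
  have h1 := two_mul_multichoose_three (d * m)
  have h2 := two_mul_multichoose_three ((d + 1) * m)
  linarith

section Straightening

variable {B : Type*} [CommRing B]

/-- The standard monomials of degree `d` in `y_m, …, y_{2m}`. -/
def lowMonomial (m d : ℕ) (y : ℕ → B) : Option (Fin d × Fin m) → B
  | none => y (2 * m) ^ d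
  | some (p, k) => y m ^ (p : ℕ) * y (m + k) * y (2 * m) ^ (d - 1 - p)

/-- The standard monomials of degree `d` in `y_r, …, y_{2m}` for `m < r`. -/
def highMonomial (m r d : ℕ) (y : ℕ → B) (j : Fin (2 * m + 1 - r)) : B :=
  y (r + j) * y (2 * m) ^ (d - 1)

theorem comp_lowMonomial {B' : Type*} [CommRing B'] (f : B →+* B') (m d : ℕ) (y : ℕ → B) :
    f ∘ lowMonomial m d y = lowMonomial m d (f ∘ y) := by
  ext z
  rcases z with _ | z <;> simp [lowMonomial]

theorem comp_highMonomial {B' : Type*} [CommRing B'] (f : B →+* B') (m r d : ℕ) (y : ℕ → B) :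
    f ∘ highMonomial m r d y = highMonomial m r d (f ∘ y) := by
  ext z
  simp [highMonomial]

theorem exists_lowMonomial_eq {m : ℕ} (y : ℕ → B) {d : ℕ} (hd : 1 ≤ d)
    (z : Option (Fin d × Fin m)) :
    ∃ p q k, p + q + 1 = d ∧ m ≤ k ∧ k ≤ 2 * m ∧
      lowMonomial m d y z = y m ^ p * y k * y (2 * m) ^ q := by
  rcases z with _ | ⟨p, k⟩
  · refine ⟨0, d - 1, 2 * m, by omega, by omega, le_rfl, ?_⟩
    obtain ⟨d, rfl⟩ := Nat.exists_eq_add_of_le' hd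
    simp only [lowMonomial, Nat.add_sub_cancel]
    ring
  · exact ⟨p, d - 1 - p, m + k, by omega, by omega, by omega, rfl⟩

variable [Algebra ℂ B]

/-- The relations that hold between the variables `y_0, …, y_{2m}` in the colon ideal quotient
`ℂ[x] / ((J + (x_0, …, x_{r-1})) : x_r)`. -/
structure ColonRelations (m r : ℕ) (y : ℕ → B) : Prop where
  zero : ∀ i < r, y i = 0
  minor : ∀ b c, r ≤ b → b < c → c ≤ 2 * m →
    ((b : ℂ) * ((m : ℂ) - c)) • (y (b - 1) * y c) = ((c : ℂ) * ((m : ℂ) - b)) • (y b * y (c - 1))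

namespace ColonRelations

variable {m r : ℕ} {y : ℕ → B}

theorem eq_zero_of_coeff {a : ℂ} {z : B} (ha : a ≠ 0) (h : a • z = 0) : z = 0 := by
  rw [← inv_smul_smul₀ ha z, h, smul_zero]

theorem mul_eq_zero_of_two_mul_le (h : ColonRelations m r y) {i c : ℕ} (him : i < m)
    (hri : r ≤ i + 1) (hc : c ≤ 2 * m) (hic : 2 * m ≤ i + c) : y i * y c = 0 := by
  obtain ⟨t, ht⟩ : ∃ t, i + 1 + t = m := ⟨m - (i + 1), by omega⟩
  induction t generalizing i c with
  | zero =>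
    refine eq_zero_of_coeff ?_ ((h.minor (i + 1) c hri (by omega) hc).trans ?_)
    · refine mul_ne_zero (by exact_mod_cast i.succ_ne_zero) (sub_ne_zero.2 ?_)
      exact_mod_cast (show m ≠ c by omega)
    · rw [add_zero] at ht
      rw [ht, sub_self, mul_zero, zero_smul]
  | succ t ih =>
    refine eq_zero_of_coeff ?_ ((h.minor (i + 1) c hri (by omega) hc).trans ?_)
    · refine mul_ne_zero (by exact_mod_cast i.succ_ne_zero) (sub_ne_zero.2 ?_)
      exact_mod_cast (show m ≠ c by omega)
    · rw [ih (i := i + 1) (c := c - 1) (by omega) (by omega) (by omega) (by omega) (by omega),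
        smul_zero]

theorem mul_eq_zero (h : ColonRelations m r y) (hr1 : 1 ≤ r) {i k : ℕ} (him : i < m)
    (hk : k ≤ 2 * m) : y i * y k = 0 := by
  induction i using Nat.strong_induction_on generalizing k with
  | _ i ih =>
    by_cases hir : i < r
    · rw [h.zero _ hir, zero_mul]
    rcases lt_or_ge k i with hki | hki
    · rw [mul_comm, ih k hki (by omega) (by omega)]
    rcases hk.eq_or_lt with rfl | hk
    · exact h.mul_eq_zero_of_two_mul_le him (by omega) le_rfl (by omega)
    have hrel := h.minor i (k + 1) (by omega) (by omega) (by omega)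
    rw [ih (i - 1) (by omega) (by omega) (by omega), smul_zero, Nat.add_sub_cancel] at hrel
    refine eq_zero_of_coeff (mul_ne_zero ?_ (sub_ne_zero.2 ?_)) hrel.symm
    · exact_mod_cast k.succ_ne_zero
    · exact_mod_cast him.ne'

theorem exists_shift (h : ColonRelations m r y) {i k : ℕ} (hri : r ≤ i) (hmi : m < i)
    (hi : i ≤ 2 * m) (hrk : r ≤ k + 1) (hk : k < 2 * m) :
    ∃ a : ℂ, y i * y k = a • (y (i - 1) * y (k + 1)) := by
  have hne : ((k + 1 : ℕ) : ℂ) * ((m : ℂ) - i) ≠ 0 :=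
    mul_ne_zero (by exact_mod_cast k.succ_ne_zero) (sub_ne_zero.2 (by exact_mod_cast hmi.ne))
  rcases lt_trichotomy i (k + 1) with hik | rfl | hik
  · have hrel := h.minor i (k + 1) hri hik (by omega)
    rw [Nat.add_sub_cancel] at hrel
    refine ⟨(((k + 1 : ℕ) : ℂ) * ((m : ℂ) - i))⁻¹ * ((i : ℂ) * ((m : ℂ) - (k + 1 : ℕ))), ?_⟩
    rw [mul_smul, hrel, inv_smul_smul₀ hne]
  · exact ⟨1, by rw [one_smul, Nat.add_sub_cancel, mul_comm]⟩
  · have hrel := h.minor (k + 1) i hrk hik hi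
    rw [Nat.add_sub_cancel] at hrel
    refine ⟨(((k + 1 : ℕ) : ℂ) * ((m : ℂ) - i))⁻¹ * ((i : ℂ) * ((m : ℂ) - (k + 1 : ℕ))), ?_⟩
    rw [mul_smul, mul_comm (y (i - 1)), ← hrel, inv_smul_smul₀ hne, mul_comm]

theorem exists_mul_eq_low (h : ColonRelations m r y) (hr : r ≤ m) :
    ∀ i k, m ≤ i → m ≤ k → i + k ≤ 3 * m → ∃ a : ℂ, y i * y k = a • (y m * y (i + k - m)) := by
  intro i
  induction i with
  | zero =>
    intro k hi hk hik
    obtain rfl : m = 0 := by omega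
    exact ⟨1, by simp⟩
  | succ i ih =>
    intro k hi hk hik
    rcases hi.eq_or_lt with rfl | hi
    · exact ⟨1, by rw [one_smul, Nat.add_sub_cancel_left]⟩
    obtain ⟨a, ha⟩ := h.exists_shift (i := i + 1) (k := k) (by omega) hi (by omega) (by omega)
      (by omega)
    obtain ⟨b, hb⟩ := ih (k + 1) (by omega) (by omega) (by omega)
    refine ⟨a * b, ?_⟩
    rw [ha, Nat.add_sub_cancel, hb, mul_smul, show i + (k + 1) = i + 1 + k by omega]

theorem exists_mul_eq_high (h : ColonRelations m r y) (hr : r ≤ m) :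
    ∀ i k, m ≤ i → i ≤ 2 * m → m ≤ k → k ≤ 2 * m → 3 * m ≤ i + k →
      ∃ a : ℂ, y i * y k = a • (y (i + k - 2 * m) * y (2 * m)) := by
  intro i
  induction i with
  | zero =>
    intro k hi _ hk _ hik
    obtain rfl : m = 0 := by omega
    obtain rfl : k = 0 := by omega
    exact ⟨1, by simp⟩
  | succ i ih =>
    intro k hi hi' hk hk' hik
    rcases hk'.eq_or_lt with rfl | hk'
    · exact ⟨1, by rw [one_smul, Nat.add_sub_cancel]⟩
    obtain ⟨a, ha⟩ := h.exists_shift (i := i + 1) (k := k) (by omega) (by omega) (by omega)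
      (by omega) (by omega)
    obtain ⟨b, hb⟩ := ih (k + 1) (by omega) (by omega) (by omega) (by omega) (by omega)
    refine ⟨a * b, ?_⟩
    rw [ha, Nat.add_sub_cancel, hb, mul_smul, show i + (k + 1) = i + 1 + k by omega]

theorem exists_mul_eq_of_lt (h : ColonRelations m r y) (hr : m < r) :
    ∀ i k, i ≤ 2 * m → k ≤ 2 * m →
      ∃ a : ℂ, y i * y k = a • (y (i + k - 2 * m) * y (2 * m)) := by
  intro i
  induction i with
  | zero => exact fun k _ _ ↦ ⟨0, by rw [h.zero 0 (by omega), zero_mul, zero_smul]⟩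
  | succ i ih =>
    intro k hi hk
    by_cases hir : i + 1 < r
    · exact ⟨0, by rw [h.zero _ hir, zero_mul, zero_smul]⟩
    by_cases hkr : k < r
    · exact ⟨0, by rw [h.zero _ hkr, mul_zero, zero_smul]⟩
    rcases hk.eq_or_lt with rfl | hk
    · exact ⟨1, by rw [one_smul, Nat.add_sub_cancel]⟩
    obtain ⟨a, ha⟩ := h.exists_shift (i := i + 1) (k := k) (by omega) (by omega) (by omega)
      (by omega) hk
    obtain ⟨b, hb⟩ := ih (k + 1) (by omega) (by omega)
    refine ⟨a * b, ?_⟩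
    rw [ha, Nat.add_sub_cancel, hb, mul_smul, show i + (k + 1) = i + 1 + k by omega]

theorem pow_mul_mul_pow_mem_span_lowMonomial (y : ℕ → B) {k : ℕ} (hmk : m ≤ k) (hk : k ≤ 2 * m)
    (p q : ℕ) :
    y m ^ p * y k * y (2 * m) ^ q ∈ Submodule.span ℂ (Set.range (lowMonomial m (p + q + 1) y)) := by
  rcases hk.eq_or_lt with rfl | hk
  · refine Submodule.subset_span ?_
    rcases Nat.eq_zero_or_pos m with rfl | hm
    · refine ⟨none, ?_⟩
      simp only [lowMonomial, mul_zero]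
      ring
    rcases p with _ | p
    · refine ⟨none, ?_⟩
      simp only [lowMonomial]
      ring
    · refine ⟨some (⟨p, by omega⟩, ⟨0, hm⟩), ?_⟩
      change y m ^ p * y m * y (2 * m) ^ (p + 1 + q + 1 - 1 - p) = _
      rw [show p + 1 + q + 1 - 1 - p = q + 1 by omega]
      ring
  · refine Submodule.subset_span ⟨some (⟨p, by omega⟩, ⟨k - m, by omega⟩), ?_⟩
    simp only [lowMonomial]
    rw [show p + q + 1 - 1 - p = q by omega, Nat.add_sub_cancel' hmk]

theorem mul_lowMonomial_mem (h : ColonRelations m r y) (hr1 : 1 ≤ r) (hr : r ≤ m) {d j : ℕ}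
    (hd : 1 ≤ d) (hj : j ≤ 2 * m) (z : Option (Fin d × Fin m)) :
    y j * lowMonomial m d y z ∈ Submodule.span ℂ (Set.range (lowMonomial m (d + 1) y)) := by
  obtain ⟨p, q, k, rfl, hmk, hk, hz⟩ := exists_lowMonomial_eq y hd z
  rw [hz]
  rcases lt_or_ge j m with hjm | hmj
  · have h0 := h.mul_eq_zero hr1 hjm hk
    rw [show y j * (y m ^ p * y k * y (2 * m) ^ q) = y j * y k * (y m ^ p * y (2 * m) ^ q) by ring,
      h0, zero_mul]
    exact zero_mem _
  have hexp : y j * (y m ^ p * y k * y (2 * m) ^ q) = y m ^ p * (y j * y k) * y (2 * m) ^ q := by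
    ring
  rw [hexp]
  rcases le_total (j + k) (3 * m) with hjk | hjk
  · obtain ⟨a, ha⟩ := h.exists_mul_eq_low hr j k hmj hmk hjk
    rw [ha, mul_smul_comm, smul_mul_assoc]
    refine Submodule.smul_mem _ _ ?_
    have := pow_mul_mul_pow_mem_span_lowMonomial (m := m) y (k := j + k - m) (by omega) (by omega)
      (p + 1) q
    rw [show p + 1 + q + 1 = p + q + 1 + 1 by ring] at this
    convert this using 1
    ring
  · obtain ⟨a, ha⟩ := h.exists_mul_eq_high hr j k hmj hj hmk hk hjk
    rw [ha, mul_smul_comm, smul_mul_assoc]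
    refine Submodule.smul_mem _ _ ?_
    have := pow_mul_mul_pow_mem_span_lowMonomial (m := m) y (k := j + k - 2 * m) (by omega)
      (by omega) p (q + 1)
    rw [show p + (q + 1) + 1 = p + q + 1 + 1 by ring] at this
    convert this using 1
    ring

theorem mul_highMonomial_mem (h : ColonRelations m r y) (hr : m < r) {d j : ℕ}
    (hd : 1 ≤ d) (hj : j ≤ 2 * m) (z : Fin (2 * m + 1 - r)) :
    y j * highMonomial m r d y z ∈ Submodule.span ℂ (Set.range (highMonomial m r (d + 1) y)) := by
  obtain ⟨d, rfl⟩ := Nat.exists_eq_add_of_le' hd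
  have hz := z.2
  obtain ⟨a, ha⟩ := h.exists_mul_eq_of_lt hr j (r + z) hj (by omega)
  simp only [highMonomial, Nat.add_sub_cancel]
  rw [← mul_assoc, ha, smul_mul_assoc, mul_assoc, ← pow_succ']
  refine Submodule.smul_mem _ _ ?_
  rcases lt_or_ge (j + (r + z) - 2 * m) r with hlt | hge
  · rw [h.zero _ hlt, zero_mul]
    exact zero_mem _
  · refine Submodule.subset_span ⟨⟨j + (r + z) - 2 * m - r, by omega⟩, ?_⟩
    simp only [highMonomial, Nat.add_sub_cancel]
    rw [Nat.add_sub_cancel' hge]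

/-- The span of the degree-`d` monomials in `y_0, …, y_{2m}` is contained in the span of the
standard ones. -/
theorem span_pow_le_span_lowMonomial (h : ColonRelations m r y) (hr1 : 1 ≤ r) (hr : r ≤ m) {d : ℕ}
    (hd : 2 ≤ d) :
    Submodule.span ℂ (y '' Set.Iic (2 * m)) ^ d ≤
      Submodule.span ℂ (Set.range (lowMonomial m d y)) := by
  induction d, hd using Nat.le_induction with
  | base =>
    rw [pow_two, Submodule.span_mul_span, Submodule.span_le]
    rintro _ ⟨_, ⟨i, hi, rfl⟩, _, ⟨k, hk, rfl⟩, rfl⟩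
    rcases lt_or_ge i m with him | him
    · change y i * y k ∈ _
      rw [h.mul_eq_zero hr1 him hk]
      exact zero_mem _
    have := pow_mul_mul_pow_mem_span_lowMonomial (m := m) y him hi 0 0
    rw [pow_zero, pow_zero, one_mul, mul_one] at this
    obtain ⟨s, hs⟩ := (Submodule.mem_span_range_iff_exists_fun ℂ).1 this
    change y i * y k ∈ _
    rw [mul_comm, ← hs, Finset.mul_sum]
    refine Submodule.sum_mem _ fun z _ ↦ ?_
    rw [mul_smul_comm]
    exact Submodule.smul_mem _ _ (h.mul_lowMonomial_mem hr1 hr le_rfl hk z)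
  | succ d hd ih =>
    rw [pow_succ']
    refine (mul_le_mul_right ih _).trans ?_
    rw [Submodule.span_mul_span, Submodule.span_le]
    rintro _ ⟨_, ⟨j, hj, rfl⟩, _, ⟨z, rfl⟩, rfl⟩
    exact h.mul_lowMonomial_mem hr1 hr (by omega) hj z

theorem span_pow_le_span_highMonomial (h : ColonRelations m r y) (hr : m < r) {d : ℕ}
    (hd : 1 ≤ d) :
    Submodule.span ℂ (y '' Set.Iic (2 * m)) ^ d ≤
      Submodule.span ℂ (Set.range (highMonomial m r d y)) := by
  induction d, hd using Nat.le_induction with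
  | base =>
    rw [pow_one, Submodule.span_le]
    rintro _ ⟨k, hk, rfl⟩
    rcases lt_or_ge k r with hkr | hkr
    · rw [h.zero k hkr]
      exact zero_mem _
    · rw [Set.mem_Iic] at hk
      refine Submodule.subset_span ⟨⟨k - r, by omega⟩, ?_⟩
      simp only [highMonomial]
      rw [Nat.add_sub_cancel' hkr, Nat.sub_self, pow_zero, mul_one]
  | succ d hd ih =>
    rw [pow_succ']
    refine (mul_le_mul_right ih _).trans ?_
    rw [Submodule.span_mul_span, Submodule.span_le]
    rintro _ ⟨_, ⟨j, hj, rfl⟩, _, ⟨z, rfl⟩, rfl⟩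
    exact h.mul_highMonomial_mem hr hd hj z

end ColonRelations

end Straightening

/-- The variable `x_i`, with `x_i = 0` for `i > ℓ`. -/
noncomputable def xvar (ℓ i : ℕ) : MvPolynomial (Fin (ℓ + 1)) ℂ :=
  if h : i < ℓ + 1 then X ⟨i, h⟩ else 0

theorem xvar_of_lt {ℓ i : ℕ} (h : i < ℓ + 1) : xvar ℓ i = X ⟨i, h⟩ := dif_pos h

theorem Ederiv_X (ℓ : ℕ) (i : Fin (ℓ + 1)) :
    Ederiv ℓ (X i) = C ((i : ℕ) : ℂ) * xvar ℓ (i - 1) := by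
  rw [Ederiv, mkDerivation_X]
  by_cases hi : i = 0
  · simp [hi]
  · rw [xvar_of_lt (by omega)]
    congr 2
    exact Fin.ext (Fin.val_sub_one_of_ne_zero hi)

theorem Fderiv_X (ℓ : ℕ) (i : Fin (ℓ + 1)) :
    Fderiv ℓ (X i) = C ((ℓ : ℂ) - ((i : ℕ) : ℂ)) * xvar ℓ (i + 1) := by
  rw [Fderiv, mkDerivation_X]
  rcases Nat.lt_succ_iff_lt_or_eq.1 i.2 with hi | hi
  · rw [xvar_of_lt (by omega)]
    congr 2
    refine Fin.ext ?_
    rw [Fin.val_add_one_of_lt (Fin.lt_def.2 hi)]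
  · simp [hi]

theorem Hderiv_X (ℓ : ℕ) (i : Fin (ℓ + 1)) :
    Hderiv ℓ (X i) = C ((ℓ : ℂ) - 2 * ((i : ℕ) : ℂ)) * xvar ℓ i := by
  rw [Hderiv, mkDerivation_X, xvar_of_lt i.2]

/-- The ideal `J + (x_0, …, x_{r-1})`. -/
noncomputable def JidealAdd (ℓ r : ℕ) : Ideal (MvPolynomial (Fin (ℓ + 1)) ℂ) :=
  Jideal ℓ ⊔ Ideal.span (xvar ℓ '' Set.Iio r)

theorem xvar_mem_JidealAdd {ℓ r i : ℕ} (h : i < r) : xvar ℓ i ∈ JidealAdd ℓ r :=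
  Ideal.mem_sup_right (Ideal.subset_span ⟨i, h, rfl⟩)

theorem xvar_mul_minor_mem (m : ℕ) {r b c : ℕ} (hr : 1 ≤ r) (hrb : r ≤ b) (hbc : b < c)
    (hc : c ≤ 2 * m) :
    (((b : ℂ) * ((m : ℂ) - c)) • (xvar (2 * m) (b - 1) * xvar (2 * m) c) -
      ((c : ℂ) * ((m : ℂ) - b)) • (xvar (2 * m) b * xvar (2 * m) (c - 1))) * xvar (2 * m) r ∈
      JidealAdd (2 * m) r := by
  have hP : Pabc (2 * m) ⟨r - 1, by omega⟩ ⟨b, by omega⟩ ⟨c, by omega⟩ ∈ JidealAdd (2 * m) r :=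
    Ideal.mem_sup_left (Ideal.subset_span ⟨_, _, _, Fin.mk_lt_mk.2 (by omega),
      Fin.mk_lt_mk.2 hbc, rfl⟩)
  have h1 := xvar_mem_JidealAdd (ℓ := 2 * m) (show r - 1 < r by omega)
  have h2 := xvar_mem_JidealAdd (ℓ := 2 * m) (show r - 1 - 1 < r by omega)
  rw [Pabc, Matrix.det_fin_three] at hP
  simp only [Ederiv_X, Fderiv_X, Hderiv_X, Matrix.of_apply, Matrix.cons_val', Matrix.cons_val_zero,
    Matrix.cons_val_one, Matrix.cons_val, Nat.sub_add_cancel hr] at hP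
  have hne : -2 * ((2 * m : ℕ) - (r - 1 : ℕ) : ℂ) ≠ 0 := by
    refine mul_ne_zero (by norm_num) (sub_ne_zero.2 ?_)
    exact_mod_cast (show 2 * m ≠ r - 1 by omega)
  have hunit : IsUnit (C (-2 * ((2 * m : ℕ) - (r - 1 : ℕ) : ℂ)) :
      MvPolynomial (Fin (2 * m + 1)) ℂ) := (isUnit_iff_ne_zero.2 hne).map C
  rw [← Ideal.unit_mul_mem_iff_mem _ hunit]
  refine (Ideal.add_mem_iff_left _ (add_mem (Ideal.mul_mem_right
    (C (((2 * m : ℕ) : ℂ) - 2 * ((r - 1 : ℕ) : ℂ)) *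
      (C (b : ℂ) * xvar (2 * m) (b - 1) * (C (((2 * m : ℕ) : ℂ) - c) * xvar (2 * m) (c + 1)) -
      C (((2 * m : ℕ) : ℂ) - b) * xvar (2 * m) (b + 1) * (C (c : ℂ) * xvar (2 * m) (c - 1)))) _ h1)
    (Ideal.mul_mem_right
    (C ((r - 1 : ℕ) : ℂ) *
      (C (((2 * m : ℕ) : ℂ) - b) * xvar (2 * m) (b + 1) *
        (C (((2 * m : ℕ) : ℂ) - 2 * c) * xvar (2 * m) c) -
      C (((2 * m : ℕ) : ℂ) - 2 * b) * xvar (2 * m) b *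
        (C (((2 * m : ℕ) : ℂ) - c) * xvar (2 * m) (c + 1)))) _ h2))).1 ?_
  convert hP using 1
  simp only [smul_eq_C_mul, C_mul, C_sub, C_neg, Nat.cast_mul, Nat.cast_ofNat]
  ring

theorem colonRelations (m : ℕ) {r : ℕ} (hr : 1 ≤ r) :
    ColonRelations m r (fun i ↦ Ideal.Quotient.mkₐ ℂ
      ((JidealAdd (2 * m) r).colon {xvar (2 * m) r}) (xvar (2 * m) i)) where
  zero i hi := by
    refine Ideal.Quotient.eq_zero_iff_mem.2 (Submodule.mem_colon_singleton.2 ?_)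
    exact Ideal.mul_mem_right _ _ (xvar_mem_JidealAdd hi)
  minor b c hb hbc hc := by
    simp only [← map_mul, ← map_smul]
    exact Ideal.Quotient.eq.2 (Submodule.mem_colon_singleton.2
      (xvar_mul_minor_mem m hr hb hbc hc))

theorem homogeneousSubmodule_one_eq_span_xvar (ℓ : ℕ) :
    homogeneousSubmodule (Fin (ℓ + 1)) ℂ 1 = Submodule.span ℂ (xvar ℓ '' Set.Iic ℓ) := by
  rw [homogeneousSubmodule_one_eq_span_X]
  congr 1
  ext p
  constructor
  · rintro ⟨i, rfl⟩
    exact ⟨i, by simp; omega, xvar_of_lt i.2⟩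
  · rintro ⟨i, hi, rfl⟩
    exact ⟨⟨i, Nat.lt_succ_of_le hi⟩, (xvar_of_lt _).symm⟩

theorem isHomogeneous_xvar (ℓ i : ℕ) : (xvar ℓ i).IsHomogeneous 1 := by
  unfold xvar
  split_ifs
  · exact isHomogeneous_X _ _
  · exact isHomogeneous_zero _ _ _

theorem exists_finset_of_colon (m : ℕ) {d r k : ℕ} {ι : Type*} [Fintype ι]
    (hcard : Fintype.card ι = k)
    (z : ι → MvPolynomial (Fin (2 * m + 1)) ℂ) (hz : ∀ i, (z i).IsHomogeneous d)
    (hspan : Submodule.span ℂ ((fun i ↦ Ideal.Quotient.mkₐ ℂ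
      ((JidealAdd (2 * m) r).colon {xvar (2 * m) r}) (xvar (2 * m) i)) '' Set.Iic (2 * m)) ^ d ≤
      Submodule.span ℂ (Set.range (Ideal.Quotient.mkₐ ℂ
        ((JidealAdd (2 * m) r).colon {xvar (2 * m) r}) ∘ z))) :
    ∃ T : Finset (MvPolynomial (Fin (2 * m + 1)) ℂ), T.card ≤ k ∧
      (∀ t ∈ T, t.IsHomogeneous (d + 1)) ∧
      ∀ g ∈ homogeneousSubmodule (Fin (2 * m + 1)) ℂ d,
        xvar (2 * m) r * g ∈
          (JidealAdd (2 * m) r).restrictScalars ℂ ⊔ Submodule.span ℂ (T : Set _) := by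
  classical
  set π := Ideal.Quotient.mkₐ ℂ ((JidealAdd (2 * m) r).colon {xvar (2 * m) r})
  refine ⟨Finset.univ.image fun i ↦ xvar (2 * m) r * z i, ?_, ?_, ?_⟩
  · exact Finset.card_image_le.trans hcard.le
  · intro t ht
    obtain ⟨i, -, rfl⟩ := Finset.mem_image.1 ht
    exact Nat.add_comm d 1 ▸ (isHomogeneous_xvar _ _).mul (hz i)
  · intro g hg
    rw [← homogeneousSubmodule_one_pow, homogeneousSubmodule_one_eq_span_xvar] at hg
    have hπg := Submodule.mem_map_of_mem (f := π.toLinearMap) hg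
    rw [Submodule.map_pow, Submodule.map_span, ← Set.image_comp] at hπg
    have hmem := hspan hπg
    rw [Set.range_comp, ← AlgHom.coe_toLinearMap, ← Submodule.map_span] at hmem
    obtain ⟨t, ht, htg⟩ := hmem
    have hdiff : (g - t) * xvar (2 * m) r ∈ JidealAdd (2 * m) r :=
      Submodule.mem_colon_singleton.1 (Ideal.Quotient.eq.1 htg.symm)
    have ht' : xvar (2 * m) r * t ∈ Submodule.span ℂ
        ((Finset.univ.image fun i ↦ xvar (2 * m) r * z i : Finset _) : Set
          (MvPolynomial (Fin (2 * m + 1)) ℂ)) := by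
      have := Submodule.mem_map_of_mem (f := LinearMap.mulLeft ℂ (xvar (2 * m) r)) ht
      rw [Submodule.map_span, ← Set.range_comp] at this
      rw [Finset.coe_image, Finset.coe_univ, Set.image_univ]
      exact this
    rw [show xvar (2 * m) r * g = (g - t) * xvar (2 * m) r + xvar (2 * m) r * t by ring]
    exact Submodule.add_mem_sup hdiff ht'

theorem exists_standard_of_colon (m : ℕ) {d r : ℕ} (hd : 2 ≤ d) (hr : r ∈ Finset.Icc 1 (2 * m)) :
    ∃ T : Finset (MvPolynomial (Fin (2 * m + 1)) ℂ), T.card ≤ standardCount m d r ∧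
      (∀ t ∈ T, t.IsHomogeneous (d + 1)) ∧
      ∀ g ∈ homogeneousSubmodule (Fin (2 * m + 1)) ℂ d,
        xvar (2 * m) r * g ∈
          (JidealAdd (2 * m) r).restrictScalars ℂ ⊔ Submodule.span ℂ (T : Set _) := by
  rw [Finset.mem_Icc] at hr
  have hrel := colonRelations m hr.1
  by_cases hrm : r ≤ m
  · refine exists_finset_of_colon m ?_ (lowMonomial m d (xvar (2 * m))) ?_ ?_
    · simp [standardCount, hrm]
    · intro i
      obtain ⟨p, q, k, rfl, -, -, hz⟩ := exists_lowMonomial_eq (xvar (2 * m)) (by omega) i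
      rw [hz]
      convert (((isHomogeneous_xvar (2 * m) m).pow p).mul (isHomogeneous_xvar (2 * m) k)).mul
        ((isHomogeneous_xvar (2 * m) (2 * m)).pow q) using 1
      ring
    · rw [← AlgHom.coe_toRingHom, comp_lowMonomial]
      exact hrel.span_pow_le_span_lowMonomial hr.1 hrm hd
  · refine exists_finset_of_colon m ?_ (highMonomial m r d (xvar (2 * m))) ?_ ?_
    · simp [standardCount, hrm]
    · intro i
      have := (isHomogeneous_xvar (2 * m) (r + i)).mul
        ((isHomogeneous_xvar (2 * m) (2 * m)).pow (d - 1))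
      rwa [one_mul, Nat.add_sub_cancel' (by omega)] at this
    · rw [← AlgHom.coe_toRingHom, comp_highMonomial]
      exact hrel.span_pow_le_span_highMonomial (not_le.1 hrm) (by omega)

attribute [local instance] MvPolynomial.gradedAlgebra

theorem isHomogeneous_Jideal (ℓ : ℕ) :
    (Jideal ℓ).IsHomogeneous (homogeneousSubmodule (Fin (ℓ + 1)) ℂ) := by
  refine Ideal.homogeneous_span _ _ ?_
  rintro _ ⟨a, b, c, -, -, rfl⟩
  have hE (i : Fin (ℓ + 1)) : (Ederiv ℓ (X i)).IsHomogeneous 1 := by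
    rw [Ederiv_X]
    exact (isHomogeneous_xvar _ _).C_mul _
  have hF (i : Fin (ℓ + 1)) : (Fderiv ℓ (X i)).IsHomogeneous 1 := by
    rw [Fderiv_X]
    exact (isHomogeneous_xvar _ _).C_mul _
  have hH (i : Fin (ℓ + 1)) : (Hderiv ℓ (X i)).IsHomogeneous 1 := by
    rw [Hderiv_X]
    exact (isHomogeneous_xvar _ _).C_mul _
  refine ⟨3, ?_⟩
  simp only [Pabc, Matrix.det_fin_three, Matrix.of_apply, Matrix.cons_val', Matrix.cons_val_zero,
    Matrix.cons_val_one, Matrix.cons_val]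
  exact (((((((hE a).mul (hF b)).mul (hH c)).sub (((hE a).mul (hH b)).mul (hF c))).sub
    (((hF a).mul (hE b)).mul (hH c))).add (((hF a).mul (hH b)).mul (hE c))).add
    (((hH a).mul (hE b)).mul (hF c))).sub (((hH a).mul (hF b)).mul (hE c))

/-- The degree-`n` part of `ℂ[x_0, …, x_ℓ] / J`. -/
noncomputable abbrev quotientComponent (ℓ n : ℕ) :
    Submodule ℂ (MvPolynomial (Fin (ℓ + 1)) ℂ ⧸ Jideal ℓ) :=
  Submodule.map (Ideal.Quotient.mkₐ ℂ (Jideal ℓ)).toLinearMap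
    (homogeneousSubmodule (Fin (ℓ + 1)) ℂ n)

instance (ℓ n : ℕ) : FiniteDimensional ℂ (homogeneousSubmodule (Fin (ℓ + 1)) ℂ n) :=
  Module.Finite.iff_fg.2 (homogeneousSubmodule_fg _ _ n)

theorem homogeneousComponent_mul_of_isHomogeneous_one {σ : Type*} {R : Type*} [CommSemiring R]
    {p : MvPolynomial σ R} (hp : p.IsHomogeneous 1) (a : MvPolynomial σ R) (d : ℕ) :
    homogeneousComponent (d + 1) (a * p) = homogeneousComponent d a * p := by
  have := DirectSum.coe_decompose_mul_add_of_right_mem (homogeneousSubmodule σ R) (i := d) (a := a)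
    ((mem_homogeneousSubmodule 1 p).2 hp)
  have hd (q : MvPolynomial σ R) (k : ℕ) :
      (DirectSum.decompose (homogeneousSubmodule σ R) q k : MvPolynomial σ R) =
        homogeneousComponent k q := decomposition.decompose'_apply q k
  rwa [hd, hd] at this

theorem mem_of_mem_JidealAdd {ℓ d r : ℕ} {N : Submodule ℂ (MvPolynomial (Fin (ℓ + 1)) ℂ)}
    (hJ : (Jideal ℓ).restrictScalars ℂ ≤ N)
    (hN : ∀ i < r, ∀ g ∈ homogeneousSubmodule (Fin (ℓ + 1)) ℂ d, xvar ℓ i * g ∈ N)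
    {f : MvPolynomial (Fin (ℓ + 1)) ℂ} (hf : f.IsHomogeneous (d + 1))
    (hfJ : f ∈ JidealAdd ℓ r) : f ∈ N := by
  obtain ⟨j, hj, s, hs, rfl⟩ := Submodule.mem_sup.1 hfJ
  rw [← homogeneousComponent_eq_self hf, map_add]
  refine add_mem (hJ (homogeneousComponent_mem_of_mem (isHomogeneous_Jideal ℓ) hj _)) ?_
  clear hf hfJ
  rw [← one_mul s]
  generalize (1 : MvPolynomial (Fin (ℓ + 1)) ℂ) = a
  induction hs using Submodule.span_induction generalizing a with
  | mem x hx =>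
    obtain ⟨i, hi, rfl⟩ := hx
    rw [homogeneousComponent_mul_of_isHomogeneous_one (isHomogeneous_xvar ℓ i), mul_comm]
    exact hN i hi _ (homogeneousComponent_mem d a)
  | zero => simp
  | add x y _ _ hx hy =>
    rw [mul_add, map_add]
    exact add_mem (hx a) (hy a)
  | smul b x _ hx =>
    rw [smul_eq_mul, ← mul_assoc]
    exact hx _

/-- Modulo `J`, homogeneous polynomials of degree `d + 1` are spanned by the multiples of `x_0` and
the standard polynomials. -/
theorem exists_standard (m : ℕ) {d : ℕ} (hd : 2 ≤ d) :
    ∃ T : Finset (MvPolynomial (Fin (2 * m + 1)) ℂ),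
      T.card ≤ ∑ r ∈ Finset.Icc 1 (2 * m), standardCount m d r ∧
      homogeneousSubmodule (Fin (2 * m + 1)) ℂ (d + 1) ≤
        (Jideal (2 * m)).restrictScalars ℂ ⊔
          ((homogeneousSubmodule (Fin (2 * m + 1)) ℂ d).map
            (LinearMap.mulLeft ℂ (xvar (2 * m) 0)) ⊔ Submodule.span ℂ (T : Set _)) := by
  classical
  choose! T hcard hhom hT using fun r (hr : r ∈ Finset.Icc 1 (2 * m)) ↦
    exists_standard_of_colon m hd hr
  refine ⟨(Finset.Icc 1 (2 * m)).biUnion T, ?_, ?_⟩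
  · exact Finset.card_biUnion_le.trans (Finset.sum_le_sum hcard)
  set N := (Jideal (2 * m)).restrictScalars ℂ ⊔
    ((homogeneousSubmodule (Fin (2 * m + 1)) ℂ d).map (LinearMap.mulLeft ℂ (xvar (2 * m) 0)) ⊔
      Submodule.span ℂ (((Finset.Icc 1 (2 * m)).biUnion T : Finset _) :
        Set (MvPolynomial (Fin (2 * m + 1)) ℂ))) with hNdef
  have hspan : ∀ r ∈ Finset.Icc 1 (2 * m), Submodule.span ℂ (T r : Set _) ≤ N := fun r hr ↦
    (Submodule.span_mono (by
      exact_mod_cast Finset.subset_biUnion_of_mem T hr)).trans (le_sup_right.trans le_sup_right)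
  have hmul : ∀ r ≤ 2 * m, ∀ g ∈ homogeneousSubmodule (Fin (2 * m + 1)) ℂ d,
      xvar (2 * m) r * g ∈ N := by
    intro r
    induction r using Nat.strong_induction_on with
    | _ r ih =>
      intro hr g hg
      rcases Nat.eq_zero_or_pos r with rfl | hr0
      · exact (le_sup_left.trans le_sup_right : _ ≤ N) (Submodule.mem_map_of_mem hg)
      have hrI : r ∈ Finset.Icc 1 (2 * m) := Finset.mem_Icc.2 ⟨hr0, hr⟩
      obtain ⟨j, hj, t, ht, hjt⟩ := Submodule.mem_sup.1 (hT r hrI g hg)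
      rw [← hjt]
      refine add_mem ?_ (hspan r hrI ht)
      refine mem_of_mem_JidealAdd le_sup_left
        (fun i hi ↦ ih i hi (by omega)) ?_ hj
      rw [eq_sub_of_add_eq hjt]
      refine (Nat.add_comm d 1 ▸ (isHomogeneous_xvar _ _).mul hg).sub ?_
      exact (Submodule.span_le (p := homogeneousSubmodule _ ℂ (d + 1))).2 (hhom r hrI) ht
  rw [← homogeneousSubmodule_one_pow, pow_succ', homogeneousSubmodule_one_pow,
    homogeneousSubmodule_one_eq_span_xvar, Submodule.mul_le]
  intro x hx g hg
  induction hx using Submodule.span_induction with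
  | mem x hx =>
    obtain ⟨i, hi, rfl⟩ := hx
    exact hmul i hi g hg
  | zero => simp
  | add x y _ _ hx hy =>
    rw [add_mul]
    exact add_mem hx hy
  | smul b x _ hx =>
    rw [smul_mul_assoc]
    exact Submodule.smul_mem _ _ hx

theorem finrank_quotientComponent_succ_le (m : ℕ) {d : ℕ} (hd : 2 ≤ d) :
    Module.finrank ℂ (quotientComponent (2 * m) (d + 1)) ≤
      Module.finrank ℂ (quotientComponent (2 * m) d) +
        ∑ r ∈ Finset.Icc 1 (2 * m), standardCount m d r := by
  classical
  obtain ⟨T, hcard, hT⟩ := exists_standard m hd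
  set π := (Ideal.Quotient.mkₐ ℂ (Jideal (2 * m))).toLinearMap
  have hJ : (Jideal (2 * m)).restrictScalars ℂ = LinearMap.ker π := by
    ext f
    exact Ideal.Quotient.eq_zero_iff_mem.symm
  have hle : quotientComponent (2 * m) (d + 1) ≤
      (quotientComponent (2 * m) d).map (LinearMap.mulLeft ℂ (π (xvar (2 * m) 0))) ⊔
        Submodule.span ℂ (T.image π : Set _) := by
    refine (Submodule.map_mono hT).trans ?_
    rw [Submodule.map_sup (f := π), Submodule.map_sup (f := π), hJ,
      LinearMap.le_ker_iff_map.1 le_rfl, bot_sup_eq, Finset.coe_image, Submodule.map_span,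
      ← Submodule.map_comp, ← Submodule.map_comp]
    refine sup_le_sup_right (le_of_eq ?_) _
    congr 1
  calc Module.finrank ℂ (quotientComponent (2 * m) (d + 1))
    _ ≤ _ := Submodule.finrank_mono hle
    _ ≤ _ := Submodule.finrank_add_le_finrank_add_finrank _ _
    _ ≤ _ := add_le_add (Submodule.finrank_map_le _ _)
      ((finrank_span_finset_le_card _).trans (Finset.card_image_le.trans hcard))

theorem finrank_quotientComponent_le (m : ℕ) {n : ℕ} (hn : 2 ≤ n) :
    Module.finrank ℂ (quotientComponent (2 * m) n) ≤ Nat.multichoose 3 (n * m) := by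
  induction n, hn using Nat.le_induction with
  | base =>
    refine (Submodule.finrank_map_le _ _).trans ?_
    rw [finrank_homogeneousSubmodule, multichoose_two_eq_multichoose_three]
  | succ d hd ih =>
    rw [← multichoose_add_sum_standardCount]
    exact (finrank_quotientComponent_succ_le m hd).trans (Nat.add_le_add_right ih _)

section Model

/-- The derivation of `ℂ[a, b, c]` with `a ↦ 2b`, `b ↦ c`, `c ↦ 0`. -/
noncomputable def raising : Derivation ℂ (MvPolynomial (Fin 3) ℂ) (MvPolynomial (Fin 3) ℂ) :=
  mkDerivation ℂ ![2 * X 1, X 2, 0]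

theorem raising_X_zero : raising (X 0) = 2 * X 1 := by simp [raising]

theorem raising_X_one : raising (X 1) = X 2 := by simp [raising]

theorem raising_X_two : raising (X 2) = 0 := by simp [raising]

/-- The monomial `a ^ p * b ^ q * c ^ r`. -/
noncomputable def tri (p q r : ℕ) : MvPolynomial (Fin 3) ℂ := X 0 ^ p * X 1 ^ q * X 2 ^ r

theorem tri_mul_tri (p q r p' q' r' : ℕ) :
    tri p q r * tri p' q' r' = tri (p + p') (q + q') (r + r') := by
  simp only [tri]
  ring

theorem raising_tri (p q r : ℕ) :
    raising (tri p q r) =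
      (2 * p : ℂ) • tri (p - 1) (q + 1) r + (q : ℂ) • tri p (q - 1) (r + 1) := by
  simp only [tri, Derivation.leibniz, Derivation.leibniz_pow, raising_X_zero, raising_X_one,
    raising_X_two, smul_eq_C_mul, smul_eq_mul, nsmul_eq_mul, C_mul, map_natCast, map_ofNat]
  ring

/-- The derivatives of `a ^ m`, spanning a copy of `V_{2m}` in `ℂ[a, b, c]`. -/
noncomputable def wvec (m i : ℕ) : MvPolynomial (Fin 3) ℂ := raising^[i] (X 0 ^ m)

theorem wvec_zero (m : ℕ) : wvec m 0 = X 0 ^ m := rfl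

theorem wvec_succ (m i : ℕ) : wvec m (i + 1) = raising (wvec m i) :=
  Function.iterate_succ_apply' _ _ _

theorem X_zero_mul_wvec (m i : ℕ) :
    X 0 * wvec m (i + 1) = C (2 * m - 2 * i : ℂ) * X 1 * wvec m i +
      C (i * (2 * m - i + 1) : ℂ) * X 2 * wvec m (i - 1) := by
  induction i with
  | zero =>
    rw [wvec_succ, wvec_zero, Derivation.leibniz_pow, raising_X_zero]
    rcases m with _ | m
    · simp
    · simp [(map_ofNat C 2 : (C 2 : MvPolynomial (Fin 3) ℂ) = 2)]
      ring
  | succ i ih =>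
    have h := congrArg raising ih
    have hC (z : ℂ) : raising (C z) = 0 := raising.map_algebraMap z
    have hi : C (i * (2 * m - i + 1) : ℂ) * wvec m (i - 1 + 1) =
        C (i * (2 * m - i + 1) : ℂ) * wvec m i := by
      rcases i with _ | i
      · simp
      · rw [Nat.add_sub_cancel]
    simp only [map_add, Derivation.leibniz, smul_eq_mul, raising_X_zero, raising_X_one,
      raising_X_two, hC, ← wvec_succ] at h
    rw [Nat.add_sub_cancel]
    simp only [C_mul, C_sub, C_add, map_natCast, map_ofNat, map_one, Nat.cast_add,
      Nat.cast_one] at h hi ⊢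
    linear_combination h + X 2 * hi

theorem wvec_mem_span_tri (m i : ℕ) :
    wvec m i ∈ Submodule.span ℂ
      {f | ∃ p q r, p + q + r = m ∧ q + 2 * r = i ∧ tri p q r = f} := by
  induction i with
  | zero => exact Submodule.subset_span ⟨m, 0, 0, by omega, by omega, by simp [tri, wvec_zero]⟩
  | succ i ih =>
    rw [wvec_succ]
    change wvec m i ∈ Submodule.comap raising.toLinearMap (Submodule.span ℂ _)
    refine Submodule.span_le.2 ?_ ih
    rintro _ ⟨p, q, r, hm, hi, rfl⟩
    change raising (tri p q r) ∈ Submodule.span ℂ _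
    rw [raising_tri]
    refine add_mem ?_ ?_
    · rcases p with _ | p
      · simp
      · exact Submodule.smul_mem _ _ (Submodule.subset_span
          ⟨p, q + 1, r, by omega, by omega, rfl⟩)
    · rcases q with _ | q
      · simp
      · exact Submodule.smul_mem _ _ (Submodule.subset_span
          ⟨p, q, r + 1, by omega, by omega, rfl⟩)

theorem wvec_eq_zero (m : ℕ) {i : ℕ} (hi : 2 * m < i) : wvec m i = 0 := by
  have h := wvec_mem_span_tri m i
  rwa [(Set.eq_empty_iff_forall_notMem.2 _ : {f | ∃ p q r, p + q + r = m ∧ q + 2 * r = i ∧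
    tri p q r = f} = ∅), Submodule.span_empty, Submodule.mem_bot] at h
  rintro f ⟨p, q, r, h1, h2, -⟩
  omega

theorem isHomogeneous_tri (p q r : ℕ) : (tri p q r).IsHomogeneous (p + q + r) :=
  ((isHomogeneous_X_pow _ _).mul (isHomogeneous_X_pow _ _)).mul (isHomogeneous_X_pow _ _)

theorem isHomogeneous_wvec (m i : ℕ) : (wvec m i).IsHomogeneous m := by
  refine (Submodule.span_le (p := homogeneousSubmodule _ ℂ m)).2 ?_ (wvec_mem_span_tri m i)
  rintro _ ⟨p, q, r, rfl, -, rfl⟩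
  exact isHomogeneous_tri p q r

/-- Restriction to `a = 1`, `b = 0`. -/
noncomputable def slice : MvPolynomial (Fin 3) ℂ →ₐ[ℂ] Polynomial ℂ :=
  aeval ![1, 0, Polynomial.X]

/-- The coefficients of `slice (wvec m i)`. -/
def sliceCoeff (m : ℕ) : ℕ → ℕ
  | 0 => 1
  | 1 => 0
  | i + 2 => (i + 1) * (2 * m - i) * sliceCoeff m i

theorem slice_wvec (m : ℕ) (i : ℕ) (hi : i ≤ 2 * m + 1) :
    slice (wvec m i) = Polynomial.C (sliceCoeff m i : ℂ) * Polynomial.X ^ (i / 2) := by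
  induction i using Nat.twoStepInduction with
  | zero => simp [wvec_zero, slice, sliceCoeff]
  | one =>
    have h := congrArg slice (X_zero_mul_wvec m 0)
    simpa [slice, sliceCoeff] using h
  | more i ih _ =>
    have h := congrArg slice (X_zero_mul_wvec m (i + 1))
    rw [map_mul, map_add, map_mul, map_mul, map_mul, map_mul, Nat.add_sub_cancel,
      ih (by omega)] at h
    simp only [slice, aeval_X, Matrix.cons_val_zero, Matrix.cons_val_one, Matrix.cons_val, one_mul,
      mul_zero, zero_mul, zero_add, algHom_C] at h
    change aeval _ _ = _
    rw [h, sliceCoeff, show (i + 2) / 2 = i / 2 + 1 by omega, Nat.cast_mul, Nat.cast_mul,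
      Nat.cast_sub (by omega)]
    simp
    ring

theorem sliceCoeff_pos (m s : ℕ) (hs : s ≤ m) : 0 < sliceCoeff m (2 * s) := by
  induction s with
  | zero => simp [sliceCoeff]
  | succ s ih =>
    rw [mul_add, mul_one, sliceCoeff]
    exact Nat.mul_pos (Nat.mul_pos (by omega) (by omega)) (ih (by omega))

theorem sliceCoeff_odd (m s : ℕ) : sliceCoeff m (2 * s + 1) = 0 := by
  induction s with
  | zero => simp [sliceCoeff]
  | succ s ih => rw [show 2 * (s + 1) + 1 = 2 * s + 1 + 2 by ring, sliceCoeff, ih, mul_zero]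

theorem exists_wvec_two_mul (m : ℕ) : ∃ k : ℂ, k ≠ 0 ∧ wvec m (2 * m) = k • X 2 ^ m := by
  have h := wvec_mem_span_tri m (2 * m)
  have hset : {f | ∃ p q r, p + q + r = m ∧ q + 2 * r = 2 * m ∧ tri p q r = f} = {X 2 ^ m} := by
    ext f
    constructor
    · rintro ⟨p, q, r, h1, h2, rfl⟩
      obtain rfl : p = 0 := by omega
      obtain rfl : q = 0 := by omega
      obtain rfl : r = m := by omega
      simp [tri]
    · rintro rfl
      exact ⟨0, 0, m, by omega, by omega, by simp [tri]⟩
  rw [hset, Submodule.mem_span_singleton] at h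
  obtain ⟨k, hk⟩ := h
  refine ⟨k, ?_, hk.symm⟩
  rintro rfl
  have hs := slice_wvec m (2 * m) (by omega)
  rw [← hk, zero_smul, map_zero] at hs
  have := (sliceCoeff_pos m m le_rfl).ne'
  simp [this] at hs

/-- The span of the monomials of degree `m` and weight `i` that are divisible by `c`. -/
noncomputable def triSpan (m i : ℕ) : Submodule ℂ (MvPolynomial (Fin 3) ℂ) :=
  Submodule.span ℂ {f | ∃ p q r, p + q + r + 1 = m ∧ q + 2 * r + 2 = i ∧ tri p q (r + 1) = f}

theorem raising_mem_triSpan {m i : ℕ} {f : MvPolynomial (Fin 3) ℂ} (hf : f ∈ triSpan m i) :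
    raising f ∈ triSpan m (i + 1) := by
  change f ∈ Submodule.comap raising.toLinearMap (triSpan m (i + 1))
  refine Submodule.span_le.2 ?_ hf
  rintro _ ⟨p, q, r, hm, hi, rfl⟩
  change raising (tri p q (r + 1)) ∈ triSpan m (i + 1)
  rw [raising_tri]
  refine add_mem ?_ ?_
  · rcases p with _ | p
    · simp
    · exact Submodule.smul_mem _ _ (Submodule.subset_span
        ⟨p, q + 1, r, by omega, by omega, rfl⟩)
  · rcases q with _ | q
    · simp
    · exact Submodule.smul_mem _ _ (Submodule.subset_span
        ⟨p, q, r + 1, by omega, by omega, rfl⟩)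

theorem exists_wvec_eq_smul_add (m : ℕ) {i : ℕ} (hi : i ≤ m) :
    ∃ k : ℂ, k ≠ 0 ∧ ∃ g ∈ triSpan m i, wvec m i = k • tri (m - i) i 0 + g := by
  induction i with
  | zero => exact ⟨1, one_ne_zero, 0, zero_mem _, by simp [wvec_zero, tri]⟩
  | succ i ih =>
    obtain ⟨k, hk, g, hg, hw⟩ := ih (by omega)
    refine ⟨k * (2 * (m - i : ℕ)), ?_, k • (i : ℂ) • tri (m - i) (i - 1) 1 + raising g, ?_, ?_⟩
    · refine mul_ne_zero hk (mul_ne_zero two_ne_zero ?_)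
      exact_mod_cast (show m - i ≠ 0 by omega)
    · refine add_mem (Submodule.smul_mem _ _ ?_) (raising_mem_triSpan hg)
      rcases i with _ | i
      · simp
      · exact Submodule.smul_mem _ _ (Submodule.subset_span
          ⟨m - (i + 1), i, 0, by omega, by omega, rfl⟩)
    · rw [wvec_succ, hw, map_add, Derivation.map_smul, raising_tri, smul_add, mul_smul k,
        show m - i - 1 = m - (i + 1) by omega, add_assoc]

end Model

/-- The rescaling of `wvec m i` satisfying the relations of the variables `x_i`. -/
noncomputable def uvec (m i : ℕ) : MvPolynomial (Fin 3) ℂ :=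
  ((2 * m).descFactorial i : ℂ)⁻¹ • wvec m i

theorem descFactorial_smul_uvec (m i : ℕ) :
    ((2 * m).descFactorial i : ℂ) • uvec m i = wvec m i := by
  rcases le_or_gt i (2 * m) with hi | hi
  · exact smul_inv_smul₀ (Nat.cast_ne_zero.2 (Nat.descFactorial_eq_zero_iff_lt.not.2 hi.not_gt)) _
  · rw [wvec_eq_zero m hi, uvec, wvec_eq_zero m hi, smul_zero, smul_zero]

/-- The algebra homomorphism from `ℂ[x_0, …, x_{2m}]` to `ℂ[a, b, c]` that corresponds to raising
quadratic forms to the power `m`. -/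
noncomputable def toTri (m : ℕ) : MvPolynomial (Fin (2 * m + 1)) ℂ →ₐ[ℂ] MvPolynomial (Fin 3) ℂ :=
  aeval fun i ↦ uvec m i

theorem toTri_xvar (m i : ℕ) : toTri m (xvar (2 * m) i) = uvec m i := by
  unfold xvar
  split_ifs with h
  · simp [toTri]
  · rw [map_zero, uvec, wvec_eq_zero m (by omega), smul_zero]

theorem uvec_relation (m : ℕ) {i : ℕ} (hi : i ≤ 2 * m) :
    X 2 * (C (i : ℂ) * uvec m (i - 1)) - X 0 * (C ((2 * m : ℕ) - i : ℂ) * uvec m (i + 1)) +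
      X 1 * (C ((2 * m : ℕ) - 2 * i : ℂ) * uvec m i) = 0 := by
  have hne : ((2 * m).descFactorial i : ℂ) ≠ 0 :=
    Nat.cast_ne_zero.2 (Nat.descFactorial_eq_zero_iff_lt.not.2 hi.not_gt)
  have hC : (C ((2 * m).descFactorial i : ℂ) : MvPolynomial (Fin 3) ℂ) ≠ 0 := by
    simpa using hne
  have h := X_zero_mul_wvec m i
  rw [← descFactorial_smul_uvec m i, ← descFactorial_smul_uvec m (i + 1),
    ← descFactorial_smul_uvec m (i - 1)] at h
  refine (mul_eq_zero.1 ?_).resolve_left hC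
  have h1 : ((2 * m).descFactorial (i + 1) : ℂ) =
      ((2 * m : ℕ) - i : ℂ) * (2 * m).descFactorial i := by
    rw [Nat.descFactorial_succ, Nat.cast_mul, Nat.cast_sub hi]
  have h2 : (i : ℂ) * (2 * m).descFactorial i =
      i * (2 * m - i + 1) * (2 * m).descFactorial (i - 1) := by
    rcases i with _ | i
    · simp
    · rw [Nat.add_sub_cancel, Nat.descFactorial_succ, Nat.cast_mul, Nat.cast_sub (by omega)]
      push_cast
      ring
  have h2' := congrArg (C : ℂ → MvPolynomial (Fin 3) ℂ) h2
  rw [h1] at h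
  have h3 : (C 2 : MvPolynomial (Fin 3) ℂ) = 2 := map_ofNat C 2
  simp only [smul_eq_C_mul, C_mul, C_sub, C_add, map_natCast, map_one, Nat.cast_mul,
    Nat.cast_ofNat, h3] at h h2' ⊢
  linear_combination -h + X 2 * uvec m (i - 1) * h2'

theorem Jideal_le_ker_toTri (m : ℕ) : Jideal (2 * m) ≤ RingHom.ker (toTri m) := by
  rw [Jideal, Ideal.span_le]
  rintro _ ⟨a, b, c, -, -, rfl⟩
  change toTri m _ = 0
  have hrel (i : Fin (2 * m + 1)) : X 2 * toTri m (Ederiv (2 * m) (X i)) -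
      X 0 * toTri m (Fderiv (2 * m) (X i)) + X 1 * toTri m (Hderiv (2 * m) (X i)) = 0 := by
    rw [Ederiv_X, Fderiv_X, Hderiv_X, map_mul, map_mul, map_mul, toTri_xvar, toTri_xvar,
      toTri_xvar]
    simpa only [algHom_C, algebraMap_eq] using uvec_relation m (Nat.le_of_lt_succ i.2)
  have ha := hrel a
  have hb := hrel b
  have hc := hrel c
  refine (mul_eq_zero.1 ?_).resolve_left (X_ne_zero (R := ℂ) (2 : Fin 3))
  simp only [Pabc, Matrix.det_fin_three, Matrix.of_apply, Matrix.cons_val', Matrix.cons_val_zero,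
    Matrix.cons_val_one, Matrix.cons_val, map_add, map_sub, map_mul]
  generalize toTri m (Ederiv (2 * m) (X a)) = ea at *
  generalize toTri m (Ederiv (2 * m) (X b)) = eb at *
  generalize toTri m (Ederiv (2 * m) (X c)) = ec at *
  generalize toTri m (Fderiv (2 * m) (X a)) = fa at *
  generalize toTri m (Fderiv (2 * m) (X b)) = fb at *
  generalize toTri m (Fderiv (2 * m) (X c)) = fc at *
  generalize toTri m (Hderiv (2 * m) (X a)) = ga at *
  generalize toTri m (Hderiv (2 * m) (X b)) = gb at *
  generalize toTri m (Hderiv (2 * m) (X c)) = gc at *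
  linear_combination (fb * gc - gb * fc) * ha - (fa * gc - ga * fc) * hb +
    (fa * gb - ga * fb) * hc

theorem map_toTri_homogeneousSubmodule_one (m : ℕ) :
    (homogeneousSubmodule (Fin (2 * m + 1)) ℂ 1).map (toTri m).toLinearMap =
      Submodule.span ℂ (wvec m '' Set.Iic (2 * m)) := by
  rw [homogeneousSubmodule_one_eq_span_xvar, Submodule.map_span]
  refine le_antisymm (Submodule.span_le.2 ?_) (Submodule.span_le.2 ?_)
  · rintro _ ⟨_, ⟨i, hi, rfl⟩, rfl⟩
    change toTri m _ ∈ Submodule.span ℂ _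
    rw [toTri_xvar]
    exact Submodule.smul_mem _ _ (Submodule.subset_span ⟨i, hi, rfl⟩)
  · rintro _ ⟨i, hi, rfl⟩
    rw [← descFactorial_smul_uvec, ← toTri_xvar]
    exact Submodule.smul_mem _ _ (Submodule.subset_span ⟨_, ⟨i, hi, rfl⟩, rfl⟩)

section Quadratic

/-- The quadratic form in `wvec m 0, …, wvec m (2 * m)` with coefficients `c`. -/
noncomputable def quadForm (m : ℕ) (c : ℕ → ℕ → ℂ) : MvPolynomial (Fin 3) ℂ :=
  ∑ i ∈ Finset.range (2 * m + 1), ∑ j ∈ Finset.range (2 * m + 1), c i j • (wvec m i * wvec m j)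

/-- The coefficients of the image of a quadratic form under `raising`. -/
def raiseCoeff (c : ℕ → ℕ → ℂ) (i j : ℕ) : ℂ :=
  (if i = 0 then 0 else c (i - 1) j) + (if j = 0 then 0 else c i (j - 1))

theorem sum_range_smul_wvec_succ (m : ℕ) (c : ℕ → ℂ) :
    ∑ i ∈ Finset.range (2 * m + 1), c i • wvec m (i + 1) =
      ∑ i ∈ Finset.range (2 * m + 1), (if i = 0 then 0 else c (i - 1)) • wvec m i := by
  rw [Finset.sum_range_succ, wvec_eq_zero m (by omega), smul_zero, add_zero,
    Finset.sum_range_succ']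
  simp

theorem raising_quadForm (m : ℕ) (c : ℕ → ℕ → ℂ) :
    raising (quadForm m c) = quadForm m (raiseCoeff c) := by
  have h1 (j : ℕ) : ∑ i ∈ Finset.range (2 * m + 1), c i j • (wvec m (i + 1) * wvec m j) =
      ∑ i ∈ Finset.range (2 * m + 1), (if i = 0 then 0 else c (i - 1) j) •
        (wvec m i * wvec m j) := by
    simp only [← smul_mul_assoc, ← Finset.sum_mul]
    rw [sum_range_smul_wvec_succ m fun i ↦ c i j]
  have h2 (i : ℕ) : ∑ j ∈ Finset.range (2 * m + 1), c i j • (wvec m i * wvec m (j + 1)) =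
      ∑ j ∈ Finset.range (2 * m + 1), (if j = 0 then 0 else c i (j - 1)) •
        (wvec m i * wvec m j) := by
    simp only [← mul_smul_comm, ← Finset.mul_sum]
    rw [sum_range_smul_wvec_succ m (c i)]
  simp only [quadForm, raiseCoeff, map_sum, Derivation.map_smul, Derivation.leibniz, ← wvec_succ,
    smul_eq_mul, smul_add, add_smul, Finset.sum_add_distrib, h2]
  rw [add_comm]
  congr 1
  rw [Finset.sum_comm, Finset.sum_comm (f := fun i j ↦
    (if i = 0 then 0 else c (i - 1) j) • (wvec m i * wvec m j))]
  refine Finset.sum_congr rfl fun j _ ↦ ?_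
  rw [← h1]
  exact Finset.sum_congr rfl fun i _ ↦ by rw [mul_comm]

theorem coeff_slice_quadForm (m : ℕ) (c : ℕ → ℕ → ℂ) (s : ℕ) :
    (slice (quadForm m c)).coeff s =
      ∑ i ∈ Finset.range (2 * m + 1), ∑ j ∈ Finset.range (2 * m + 1),
        if s = i / 2 + j / 2 then c i j * (sliceCoeff m i * sliceCoeff m j : ℕ) else 0 := by
  simp only [quadForm, map_sum, Polynomial.finsetSum_coeff]
  refine Finset.sum_congr rfl fun i hi ↦ Finset.sum_congr rfl fun j hj ↦ ?_
  rw [Finset.mem_range] at hi hj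
  rw [map_smul, map_mul, slice_wvec m i (by omega), slice_wvec m j (by omega),
    show (Polynomial.C (sliceCoeff m i : ℂ) * Polynomial.X ^ (i / 2)) *
      (Polynomial.C (sliceCoeff m j : ℂ) * Polynomial.X ^ (j / 2)) =
      Polynomial.C ((sliceCoeff m i * sliceCoeff m j : ℕ) : ℂ) *
        Polynomial.X ^ (i / 2 + j / 2) by
      rw [Nat.cast_mul, Polynomial.C_mul]; ring]
  rw [Polynomial.coeff_smul, Polynomial.coeff_C_mul_X_pow]
  split_ifs <;> simp

theorem eq_neg_one_pow_mul_of_raiseCoeff_eq_zero {L : ℕ} {c : ℕ → ℕ → ℂ}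
    (hc : ∀ i ≤ L, ∀ j ≤ L, raiseCoeff c i j = 0) {i j k : ℕ} (hi : i + k ≤ L) (hj : j + k ≤ L) :
    c i (j + k) = (-1) ^ k * c (i + k) j := by
  induction k generalizing i with
  | zero => simp
  | succ k ih =>
    have h := hc (i + 1) (by omega) (j + k + 1) (by omega)
    simp only [raiseCoeff, Nat.add_sub_cancel, Nat.succ_ne_zero, if_false] at h
    rw [← add_assoc, eq_neg_of_add_eq_zero_left h, ih (by omega) (by omega), pow_succ,
      show i + 1 + k = i + (k + 1) by omega]
    ring

theorem eq_zero_of_raiseCoeff_eq_zero {m : ℕ} {c : ℕ → ℕ → ℂ} (hsymm : ∀ i j, c i j = c j i)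
    (hc : ∀ i ≤ 2 * m, ∀ j ≤ 2 * m, raiseCoeff c i j = 0) (hQ : quadForm m c = 0) :
    ∀ i ≤ 2 * m, ∀ j ≤ 2 * m, c i j = 0 := by
  have heven_eq : ∀ p ≤ m, ∀ q ≤ m, ∀ i ≤ m, ∀ j ≤ m, p + q = i + j → i ≤ p →
      c (2 * p) (2 * q) = c (2 * i) (2 * j) := by
    intro p hp q hq i hi j hj hsum hip
    have h := eq_neg_one_pow_mul_of_raiseCoeff_eq_zero hc (i := 2 * i) (j := 2 * q)
      (k := 2 * (p - i)) (by omega) (by omega)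
    rw [pow_mul, neg_one_sq, one_pow, one_mul, show 2 * q + 2 * (p - i) = 2 * j by omega,
      show 2 * i + 2 * (p - i) = 2 * p by omega] at h
    exact h.symm
  have heven : ∀ p ≤ m, ∀ q ≤ m, c (2 * p) (2 * q) = 0 := by
    intro p hp q hq
    have h := coeff_slice_quadForm m c (p + q)
    rw [hQ, map_zero, Polynomial.coeff_zero] at h
    have hterm : ∀ i ∈ Finset.range (2 * m + 1), ∀ j ∈ Finset.range (2 * m + 1),
        (if p + q = i / 2 + j / 2 then c i j * (sliceCoeff m i * sliceCoeff m j : ℕ) else 0) =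
        c (2 * p) (2 * q) *
          ((if p + q = i / 2 + j / 2 then sliceCoeff m i * sliceCoeff m j else 0 : ℕ) : ℂ) := by
      intro i hi j hj
      rw [Finset.mem_range] at hi hj
      split_ifs with hs
      · rcases Nat.even_or_odd' i with ⟨i, rfl | rfl⟩
        · rcases Nat.even_or_odd' j with ⟨j, rfl | rfl⟩
          · rcases le_total i p with hip | hip
            · rw [heven_eq p hp q hq i (by omega) j (by omega) (by omega) hip]
            · rw [heven_eq i (by omega) j (by omega) p hp q hq (by omega) hip]
          · simp [sliceCoeff_odd]
        · simp [sliceCoeff_odd]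
      · simp
    rw [Finset.sum_congr rfl fun i hi ↦ Finset.sum_congr rfl (hterm i hi)] at h
    simp only [← Finset.mul_sum, ← Nat.cast_sum] at h
    refine (mul_eq_zero.1 h.symm).resolve_right (Nat.cast_ne_zero.2 (Nat.pos_iff_ne_zero.1 ?_))
    refine Finset.sum_pos' (fun _ _ ↦ Nat.zero_le _)
      ⟨2 * p, Finset.mem_range.2 (by omega), Finset.sum_pos' (fun _ _ ↦ Nat.zero_le _)
        ⟨2 * q, Finset.mem_range.2 (by omega), ?_⟩⟩
    rw [if_pos (by omega)]
    exact Nat.mul_pos (sliceCoeff_pos m p hp) (sliceCoeff_pos m q hq)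
  have hmixed : ∀ i ≤ 2 * m, ∀ j ≤ 2 * m, Odd (j + i) → i ≤ j → c i j = 0 := by
    intro i hi j hj hodd hij
    have h := eq_neg_one_pow_mul_of_raiseCoeff_eq_zero hc (i := i) (j := i)
      (k := j - i) (by omega) (by omega)
    rw [Nat.add_sub_cancel' hij, ((Nat.odd_sub' hij).2 (by grind)).neg_one_pow, hsymm j i] at h
    linear_combination h / 2
  intro i hi j hj
  rcases Nat.even_or_odd (j + i) with he | ho
  · rcases Nat.even_or_odd' i with ⟨p, rfl | rfl⟩
    · obtain ⟨q, rfl | rfl⟩ := Nat.even_or_odd' j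
      · exact heven p (by omega) q (by omega)
      · grind
    · obtain ⟨q, rfl | rfl⟩ := Nat.even_or_odd' j
      · grind
      · have h := eq_neg_one_pow_mul_of_raiseCoeff_eq_zero hc (i := 2 * p + 1) (j := 2 * q)
          (k := 1) (by omega) (by omega)
        rw [h, show 2 * p + 1 + 1 = 2 * (p + 1) by ring, heven _ (by omega) _ (by omega), mul_zero]
  · rcases le_total i j with hij | hij
    · exact hmixed i hi j hj ho hij
    · rw [hsymm]
      exact hmixed j hj i hi (by rwa [add_comm]) hij

theorem coeff_eq_zero_of_quadForm_eq_zero (m N : ℕ) {c : ℕ → ℕ → ℂ} (hsymm : ∀ i j, c i j = c j i)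
    (hN : ∀ i j, i + j + N ≤ 4 * m → c i j = 0) (hQ : quadForm m c = 0) :
    ∀ i ≤ 2 * m, ∀ j ≤ 2 * m, c i j = 0 := by
  induction N generalizing c with
  | zero => exact fun i hi j hj ↦ hN i j (by omega)
  | succ N ih =>
    refine eq_zero_of_raiseCoeff_eq_zero hsymm (ih (c := raiseCoeff c) ?_ ?_ ?_) hQ
    · intro i j
      rw [raiseCoeff, raiseCoeff, add_comm, hsymm (j - 1), hsymm j]
    · intro i j hij
      rw [raiseCoeff]
      split_ifs with hi hj hj
      · simp
      · rw [hN _ _ (by omega), add_zero]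
      · rw [hN _ _ (by omega), add_zero]
      · rw [hN _ _ (by omega), hN _ _ (by omega), add_zero]
    · rw [← raising_quadForm, hQ, map_zero]

end Quadratic

theorem exists_symm_coeff {ℓ : ℕ} {f : MvPolynomial (Fin (ℓ + 1)) ℂ}
    (hf : f ∈ homogeneousSubmodule (Fin (ℓ + 1)) ℂ 2) :
    ∃ c : ℕ → ℕ → ℂ, (∀ i j, c i j = c j i) ∧
      f = ∑ i ∈ Finset.range (ℓ + 1), ∑ j ∈ Finset.range (ℓ + 1),
        c i j • (xvar ℓ i * xvar ℓ j) := by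
  have hlin (x : MvPolynomial (Fin (ℓ + 1)) ℂ) (hx : x ∈ homogeneousSubmodule (Fin (ℓ + 1)) ℂ 1) :
      ∃ α : ℕ → ℂ, x = ∑ i ∈ Finset.range (ℓ + 1), α i • xvar ℓ i := by
    rw [homogeneousSubmodule_one_eq_span_X, Submodule.mem_span_range_iff_exists_fun] at hx
    obtain ⟨α, rfl⟩ := hx
    refine ⟨fun i ↦ if h : i < ℓ + 1 then α ⟨i, h⟩ else 0, ?_⟩
    rw [Finset.sum_range]
    exact Finset.sum_congr rfl fun i _ ↦ by
      simp only [i.2, ↓reduceDIte, xvar_of_lt i.2]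
  rw [← homogeneousSubmodule_one_pow, pow_two] at hf
  refine Submodule.mul_induction_on hf ?_ ?_
  · intro x hx y hy
    obtain ⟨α, rfl⟩ := hlin x hx
    obtain ⟨β, rfl⟩ := hlin y hy
    refine ⟨fun i j ↦ (α i * β j + α j * β i) / 2, fun i j ↦ by ring, ?_⟩
    have h1 : ∑ i ∈ Finset.range (ℓ + 1), ∑ j ∈ Finset.range (ℓ + 1),
        (α i * β j) • (xvar ℓ i * xvar ℓ j) =
        (∑ i ∈ Finset.range (ℓ + 1), α i • xvar ℓ i) *
          ∑ i ∈ Finset.range (ℓ + 1), β i • xvar ℓ i := by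
      simp only [Finset.sum_mul_sum, smul_mul_smul_comm]
    have h2 : ∑ i ∈ Finset.range (ℓ + 1), ∑ j ∈ Finset.range (ℓ + 1),
        (α j * β i) • (xvar ℓ i * xvar ℓ j) =
        (∑ i ∈ Finset.range (ℓ + 1), α i • xvar ℓ i) *
          ∑ i ∈ Finset.range (ℓ + 1), β i • xvar ℓ i := by
      rw [← h1, Finset.sum_comm]
      simp only [mul_comm]
    have hhalf (i j : ℕ) : ((α i * β j + α j * β i) / 2) • (xvar ℓ i * xvar ℓ j) =
        (2⁻¹ : ℂ) • ((α i * β j) • (xvar ℓ i * xvar ℓ j) +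
          (α j * β i) • (xvar ℓ i * xvar ℓ j)) := by
      module
    simp only [hhalf, ← Finset.smul_sum, Finset.sum_add_distrib, h1, h2]
    module
  · rintro _ _ ⟨c, hc, rfl⟩ ⟨c', hc', rfl⟩
    refine ⟨fun i j ↦ c i j + c' i j, fun i j ↦ by simp only [hc i, hc' i], ?_⟩
    simp only [add_smul, Finset.sum_add_distrib]

theorem eq_zero_of_toTri_eq_zero {m : ℕ} {f : MvPolynomial (Fin (2 * m + 1)) ℂ}
    (hf : f ∈ homogeneousSubmodule (Fin (2 * m + 1)) ℂ 2) (h0 : toTri m f = 0) : f = 0 := by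
  obtain ⟨c, hc, rfl⟩ := exists_symm_coeff hf
  set D : ℕ → ℂ := fun i ↦ ((2 * m).descFactorial i : ℂ)⁻¹ with hD
  have hQ : quadForm m (fun i j ↦ c i j * (D i * D j)) = 0 := by
    rw [← h0]
    simp only [map_sum, map_smul, map_mul, toTri_xvar, uvec, quadForm, smul_mul_smul_comm, mul_smul,
      hD]
  have hzero := coeff_eq_zero_of_quadForm_eq_zero m (4 * m + 1)
    (fun i j ↦ by rw [hc, mul_comm (D i)]) (fun i j hij ↦ by omega) hQ
  have hne : ∀ i ≤ 2 * m, D i ≠ 0 := fun i hi ↦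
    inv_ne_zero (Nat.cast_ne_zero.2 (Nat.descFactorial_eq_zero_iff_lt.not.2 hi.not_gt))
  refine Finset.sum_eq_zero fun i hi ↦ Finset.sum_eq_zero fun j hj ↦ ?_
  rw [Finset.mem_range] at hi hj
  have hij := hzero i (by omega) j (by omega)
  rw [(mul_eq_zero.1 hij).resolve_right (mul_ne_zero (hne i (by omega)) (hne j (by omega))),
    zero_smul]

theorem map_toTri_le (m n : ℕ) :
    (homogeneousSubmodule (Fin (2 * m + 1)) ℂ n).map (toTri m).toLinearMap ≤
      homogeneousSubmodule (Fin 3) ℂ (n * m) := by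
  rw [← homogeneousSubmodule_one_pow, Submodule.map_pow, map_toTri_homogeneousSubmodule_one]
  induction n with
  | zero =>
    rw [pow_zero, zero_mul, Submodule.one_le]
    exact isHomogeneous_one _ _
  | succ n ih =>
    rw [pow_succ, Submodule.mul_le]
    intro f hf g hg
    rw [add_mul, one_mul]
    refine IsHomogeneous.mul (ih hf) ?_
    refine (Submodule.span_le (p := homogeneousSubmodule _ ℂ m)).2 ?_ hg
    rintro _ ⟨i, -, rfl⟩
    exact isHomogeneous_wvec m i

theorem homogeneousSubmodule_le_span_tri (k : ℕ) :
    homogeneousSubmodule (Fin 3) ℂ k ≤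
      Submodule.span ℂ {f | ∃ p q r, p + q + r = k ∧ tri p q r = f} := by
  intro f hf
  rw [f.as_sum]
  refine Submodule.sum_mem _ fun d hd ↦ ?_
  have hdeg := hf (mem_support_iff.1 hd)
  rw [monomial_eq, ← smul_eq_C_mul]
  refine Submodule.smul_mem _ _ (Submodule.subset_span ⟨d 0, d 1, d 2, ?_, ?_⟩)
  · rw [← hdeg, Finsupp.weight_apply, Finsupp.sum_fintype _ _ (by simp), Fin.sum_univ_three]
    simp
  · rw [Finsupp.prod_fintype _ _ (by simp), Fin.prod_univ_three, tri]

theorem mul_mem_of_mem_triSpan {m i : ℕ} {W : Submodule ℂ (MvPolynomial (Fin 3) ℂ)}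
    {g h : MvPolynomial (Fin 3) ℂ}
    (hW : ∀ p q r, p + q + r + 1 = m → q + 2 * r + 2 = i → tri p q (r + 1) * h ∈ W)
    (hg : g ∈ triSpan m i) : g * h ∈ W := by
  rw [triSpan] at hg
  induction hg using Submodule.span_induction with
  | mem x hx =>
    obtain ⟨p, q, r, h1, h2, rfl⟩ := hx
    exact hW p q r h1 h2
  | zero =>
    rw [zero_mul]
    exact zero_mem _
  | add x y _ _ hx hy =>
    rw [add_mul]
    exact add_mem hx hy
  | smul b x _ hx =>
    rw [smul_mul_assoc]
    exact Submodule.smul_mem _ _ hx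

theorem tri_mem_span_wvec_mul {m k : ℕ} (hk : 2 * m ≤ k) (p q r : ℕ) (hsum : p + q + r = k + m) :
    tri p q r ∈ Submodule.span ℂ (wvec m '' Set.Iic (2 * m)) *
      homogeneousSubmodule (Fin 3) ℂ k := by
  set V := Submodule.span ℂ (wvec m '' Set.Iic (2 * m))
  have hV {i : ℕ} (hi : i ≤ 2 * m) : wvec m i ∈ V := Submodule.subset_span ⟨i, hi, rfl⟩
  have hR {p q r : ℕ} (h : p + q + r = k) : tri p q r ∈ homogeneousSubmodule (Fin 3) ℂ k :=
    h ▸ isHomogeneous_tri p q r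
  induction q using Nat.strong_induction_on generalizing p r with
  | _ q ih =>
    by_cases hp : m ≤ p
    · have := Submodule.mul_mem_mul (hV (Nat.zero_le _)) (hR (p := p - m) (q := q) (r := r)
        (by omega))
      rwa [wvec_zero, show (X 0 ^ m : MvPolynomial (Fin 3) ℂ) = tri m 0 0 by simp [tri],
        tri_mul_tri, Nat.add_sub_cancel' hp, zero_add, zero_add] at this
    by_cases hr : m ≤ r
    · obtain ⟨κ, hκ, hw⟩ := exists_wvec_two_mul m
      have := Submodule.mul_mem_mul (hV le_rfl) (hR (p := p) (q := q) (r := r - m) (by omega))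
      rwa [hw, show (X 2 ^ m : MvPolynomial (Fin 3) ℂ) = tri 0 0 m by simp [tri], smul_mul_assoc,
        tri_mul_tri, Nat.add_sub_cancel' hr, zero_add, zero_add,
        Submodule.smul_mem_iff _ hκ] at this
    · obtain ⟨κ, hκ, g, hg, hw⟩ := exists_wvec_eq_smul_add m le_rfl
      have := Submodule.mul_mem_mul (hV (by omega : m ≤ 2 * m))
        (hR (p := p) (q := q - m) (r := r) (by omega))
      rw [hw, add_mul, smul_mul_assoc, tri_mul_tri, Nat.sub_self, zero_add, zero_add,
        Nat.add_sub_cancel' (by omega)] at this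
      rw [← Submodule.smul_mem_iff _ hκ, ← Submodule.add_mem_iff_left _ ?_]
      · exact this
      · refine mul_mem_of_mem_triSpan (fun p' q' r' h1 h2 ↦ ?_) hg
        rw [tri_mul_tri]
        exact ih _ (by omega) _ _ (by omega)

theorem map_toTri_eq (m : ℕ) {n : ℕ} (hn : 2 ≤ n) :
    (homogeneousSubmodule (Fin (2 * m + 1)) ℂ n).map (toTri m).toLinearMap =
      homogeneousSubmodule (Fin 3) ℂ (n * m) := by
  induction n, hn using Nat.le_induction with
  | base =>
    refine Submodule.eq_of_le_of_finrank_eq (map_toTri_le m 2) ?_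
    have hinj : Function.Injective ((toTri m).toLinearMap.domRestrict
        (homogeneousSubmodule (Fin (2 * m + 1)) ℂ 2)) := by
      rw [← LinearMap.ker_eq_bot, LinearMap.ker_eq_bot']
      exact fun f hf ↦ Subtype.ext (eq_zero_of_toTri_eq_zero f.2 hf)
    rw [← LinearMap.range_domRestrict, LinearMap.finrank_range_of_inj hinj,
      finrank_homogeneousSubmodule, finrank_homogeneousSubmodule,
      multichoose_two_eq_multichoose_three]
  | succ n hn ih =>
    refine le_antisymm (map_toTri_le m (n + 1)) ?_
    rw [← homogeneousSubmodule_one_pow (σ := Fin (2 * m + 1)), pow_succ',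
      homogeneousSubmodule_one_pow, Submodule.map_mul, ih, map_toTri_homogeneousSubmodule_one]
    refine (homogeneousSubmodule_le_span_tri _).trans (Submodule.span_le.2 ?_)
    rintro _ ⟨p, q, r, hsum, rfl⟩
    exact tri_mem_span_wvec_mul (Nat.mul_le_mul_right m hn) p q r (by rw [hsum]; ring)

theorem le_finrank_quotientComponent (m : ℕ) {n : ℕ} (hn : 2 ≤ n) :
    Nat.multichoose 3 (n * m) ≤ Module.finrank ℂ (quotientComponent (2 * m) n) := by
  have h := map_toTri_eq m hn
  have hcomp : (toTri m).toLinearMap = (Ideal.Quotient.liftₐ (Jideal (2 * m)) (toTri m)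
      fun f hf ↦ Jideal_le_ker_toTri m hf).toLinearMap ∘ₗ
        (Ideal.Quotient.mkₐ ℂ (Jideal (2 * m))).toLinearMap := rfl
  rw [hcomp, Submodule.map_comp] at h
  rw [← finrank_homogeneousSubmodule, ← h]
  exact Submodule.finrank_map_le _ _

/-- For even `ℓ ≥ 2` and `n ≥ 2`, the degree-`n` component of `ℂ[x_0,…,x_ℓ]/J` has dimension
`Σ_{i=0}^{⌊nℓ/4⌋} (nℓ + 1 − 4i)`. -/
theorem dim_poisson_closure_even (ℓ n : ℕ) (hℓ : 2 ≤ ℓ) (heven : Even ℓ) (hn : 2 ≤ n) :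
    Module.finrank ℂ
        (Submodule.map (Ideal.Quotient.mkₐ ℂ (Jideal ℓ)).toLinearMap
          (homogeneousSubmodule (Fin (ℓ + 1)) ℂ n)) =
      ∑ i ∈ Finset.range (n * ℓ / 4 + 1), (n * ℓ + 1 - 4 * i) := by
  obtain ⟨m, rfl⟩ := even_iff_exists_two_mul.1 heven
  rw [Nat.mul_left_comm n 2 m, sum_range_dims]
  exact le_antisymm (finrank_quotientComponent_le m hn) (le_finrank_quotientComponent m hn)
end

section
/- Let ℓ ≥ 3 be an odd integer and n ≥ 0 an integer. Then the degree-n homogeneous component of the quotient ring ℂ[x_0,…,x_ℓ]/J is spanned over ℂ by the images of the monomials x_0^{k_0}·x_1^{k_1}⋯x_ℓ^{k_ℓ} with k_0 + k_1 + ⋯ + k_ℓ = n and k_0 + k_ℓ ≥ n − 2. In particular, for n ≥ 2 its dimension is at most C(ℓ+2,2) + (n−2)·C(ℓ+1,2). -/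
open MvPolynomial

theorem Fin.val_sub_one_eq_of_pos {ℓ : ℕ} {i : Fin (ℓ + 1)} (hi : 0 < (i : ℕ)) :
    ((i - 1 : Fin (ℓ + 1)) : ℕ) = i - 1 :=
  Fin.val_sub_one_of_ne_zero fun h => by simp [h] at hi

theorem Fin.val_add_one_eq_of_val_lt {ℓ : ℕ} {i : Fin (ℓ + 1)} (hi : (i : ℕ) < ℓ) :
    ((i + 1 : Fin (ℓ + 1)) : ℕ) = i + 1 :=
  Fin.val_add_one_of_lt (Fin.lt_def.2 (by simpa using hi))

theorem Pabc_eq (ℓ : ℕ) (a b c : Fin (ℓ + 1)) :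
    Pabc ℓ a b c =
      C ((a : ℂ) * (ℓ - b) * (ℓ - 2 * c)) * (X (a - 1) * X (b + 1) * X c)
      - C ((a : ℂ) * (ℓ - 2 * b) * (ℓ - c)) * (X (a - 1) * X b * X (c + 1))
      - C (((ℓ : ℂ) - a) * b * (ℓ - 2 * c)) * (X (a + 1) * X (b - 1) * X c)
      + C (((ℓ : ℂ) - a) * (ℓ - 2 * b) * c) * (X (a + 1) * X b * X (c - 1))
      + C (((ℓ : ℂ) - 2 * a) * b * (ℓ - c)) * (X a * X (b - 1) * X (c + 1))
      - C (((ℓ : ℂ) - 2 * a) * (ℓ - b) * c) * (X a * X (b + 1) * X (c - 1)) := by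
  rw [Pabc, Matrix.det_fin_three]
  simp only [Ederiv, Fderiv, Hderiv, mkDerivation_X, Matrix.of_apply, Matrix.cons_val, C_mul]
  ring

theorem mem_of_C_mul_mem {ℓ : ℕ} {W : Submodule ℂ (MvPolynomial (Fin (ℓ + 1)) ℂ)} {z : ℂ}
    {p : MvPolynomial (Fin (ℓ + 1)) ℂ} (hz : z ≠ 0) (h : C z * p ∈ W) : p ∈ W := by
  rwa [C_mul', W.smul_mem_iff hz] at h

theorem C_mul_mem_of_ne_zero_imp {ℓ : ℕ} {W : Submodule ℂ (MvPolynomial (Fin (ℓ + 1)) ℂ)} {z : ℂ}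
    {p : MvPolynomial (Fin (ℓ + 1)) ℂ} (h : z ≠ 0 → p ∈ W) : C z * p ∈ W := by
  by_cases hz : z = 0
  · simp [hz]
  · rw [C_mul']
    exact W.smul_mem z (h hz)

/-- Modulo the Jacobian ideal, the most concentrated monomial of `P_{abc}` is a combination of
monomials whose indices have a strictly larger sum of squares. -/
theorem leading_mul_mem {ℓ : ℕ} (hodd : Odd ℓ)
    {W : Submodule ℂ (MvPolynomial (Fin (ℓ + 1)) ℂ)} {a b c : Fin (ℓ + 1)}
    {M : MvPolynomial (Fin (ℓ + 1)) ℂ} (hab : a < b) (hbc : b < c)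
    (hJ : ∀ p ∈ Jideal ℓ, p ∈ W)
    (hW : ∀ p q s : Fin (ℓ + 1),
      ((a : ℕ) + 1) ^ 2 + (b : ℕ) ^ 2 + ((c : ℕ) - 1) ^ 2 <
        (p : ℕ) ^ 2 + (q : ℕ) ^ 2 + (s : ℕ) ^ 2 → X p * X q * X s * M ∈ W) :
    X (a + 1) * X b * X (c - 1) * M ∈ W := by
  have hab' : (a : ℕ) < b := hab
  have hbc' : (b : ℕ) < c := hbc
  have hcl : (c : ℕ) < ℓ + 1 := c.2
  have hP : Pabc ℓ a b c * M ∈ W :=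
    hJ _ (Ideal.mul_mem_right _ _ (Ideal.subset_span ⟨a, b, c, hab, hbc, rfl⟩))
  have hz : ((ℓ : ℂ) - a) * (ℓ - 2 * b) * c ≠ 0 := by
    refine mul_ne_zero (mul_ne_zero ?_ ?_) ?_
    · rw [sub_ne_zero]
      exact_mod_cast (by omega : ℓ ≠ (a : ℕ))
    · rw [sub_ne_zero]
      obtain ⟨t, ht⟩ := hodd
      exact_mod_cast (by omega : ℓ ≠ 2 * (b : ℕ))
    · exact_mod_cast (by omega : (c : ℕ) ≠ 0)
  have pos : ∀ i : Fin (ℓ + 1), ((i : ℕ) : ℂ) ≠ 0 → ((i - 1 : Fin (ℓ + 1)) : ℕ) + 1 = i := by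
    intro i hi
    have hi' : (i : ℕ) ≠ 0 := by exact_mod_cast hi
    rw [Fin.val_sub_one_eq_of_pos (by omega)]
    omega
  have lt : ∀ i : Fin (ℓ + 1), (ℓ : ℂ) - ((i : ℕ) : ℂ) ≠ 0 →
      ((i + 1 : Fin (ℓ + 1)) : ℕ) = i + 1 := by
    intro i hi
    have hi' : ℓ ≠ (i : ℕ) := by exact_mod_cast sub_ne_zero.1 hi
    have := i.2
    exact Fin.val_add_one_eq_of_val_lt (by omega)
  have ha1 := Fin.val_add_one_eq_of_val_lt (i := a) (by omega)
  have hb1 := Fin.val_add_one_eq_of_val_lt (i := b) (by omega)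
  have hb2 := Fin.val_sub_one_eq_of_pos (i := b) (by omega)
  have hc2 := Fin.val_sub_one_eq_of_pos (i := c) (by omega)
  obtain ⟨u, hu⟩ : ∃ u, (b : ℕ) = a + u + 1 := ⟨b - a - 1, by omega⟩
  obtain ⟨v, hv⟩ : ∃ v, (c : ℕ) = a + u + 1 + v + 1 := ⟨c - b - 1, by omega⟩
  have h1 : C ((a : ℂ) * (ℓ - b) * (ℓ - 2 * c)) * (X (a - 1) * X (b + 1) * X c * M) ∈ W := by
    refine C_mul_mem_of_ne_zero_imp fun h => hW _ _ _ ?_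
    have := pos a (by rintro h'; simp [h'] at h)
    rw [hb1, hv, hu, ← this]
    simp only [Nat.add_sub_cancel]
    nlinarith
  have h2 : C ((a : ℂ) * (ℓ - 2 * b) * (ℓ - c)) * (X (a - 1) * X b * X (c + 1) * M) ∈ W := by
    refine C_mul_mem_of_ne_zero_imp fun h => hW _ _ _ ?_
    have h3 := pos a (by rintro h'; simp [h'] at h)
    have h4 := lt c (by rintro h'; simp [h'] at h)
    rw [h4, hv, hu, ← h3]
    simp only [Nat.add_sub_cancel]
    nlinarith
  have h3 : C (((ℓ : ℂ) - a) * b * (ℓ - 2 * c)) * (X (a + 1) * X (b - 1) * X c * M) ∈ W := by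
    refine C_mul_mem_of_ne_zero_imp fun h => hW _ _ _ ?_
    rw [ha1, hb2, hv, hu]
    simp only [Nat.add_sub_cancel]
    nlinarith
  have h5 : C (((ℓ : ℂ) - 2 * a) * b * (ℓ - c)) * (X a * X (b - 1) * X (c + 1) * M) ∈ W := by
    refine C_mul_mem_of_ne_zero_imp fun h => hW _ _ _ ?_
    have h4 := lt c (by rintro h'; simp [h'] at h)
    rw [h4, hb2, hv, hu]
    simp only [Nat.add_sub_cancel]
    nlinarith
  have h6 : C (((ℓ : ℂ) - 2 * a) * (ℓ - b) * c) * (X a * X (b + 1) * X (c - 1) * M) ∈ W := by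
    refine C_mul_mem_of_ne_zero_imp fun h => hW _ _ _ ?_
    rw [hb1, hc2, hv, hu]
    simp only [Nat.add_sub_cancel]
    nlinarith
  refine mem_of_C_mul_mem hz ?_
  have key := W.add_mem (W.sub_mem (W.add_mem (W.add_mem (W.sub_mem hP h1) h2) h3) h5) h6
  convert key using 1
  rw [Pabc_eq]
  ring

theorem Finsupp.exists_eq_single_add_of_degree_pos {σ : Type*} {k : σ →₀ ℕ} {n : ℕ}
    (hk : n + 1 ≤ k.degree) :
    ∃ i k', k i ≠ 0 ∧ n ≤ k'.degree ∧ k = Finsupp.single i 1 + k' := by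
  have h0 : k ≠ 0 := by
    rintro rfl
    simp at hk
  obtain ⟨i, hi⟩ := Finsupp.ne_iff.1 h0
  obtain ⟨k', hk'⟩ := exists_add_of_le
    (Finsupp.single_le_iff.2 (Nat.one_le_iff_ne_zero.2 hi) : Finsupp.single i 1 ≤ k)
  refine ⟨i, k', hi, ?_, hk'⟩
  rw [hk', map_add, Finsupp.degree_single] at hk
  omega

/-- The sum of the squares of the indices of a monomial, with multiplicity. -/
noncomputable def squareWeight (ℓ : ℕ) : (Fin (ℓ + 1) →₀ ℕ) →+ ℕ :=
  Finsupp.weight fun i : Fin (ℓ + 1) => (i : ℕ) ^ 2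

theorem squareWeight_single_one {ℓ : ℕ} (i : Fin (ℓ + 1)) :
    squareWeight ℓ (Finsupp.single i 1) = (i : ℕ) ^ 2 := by
  simp [squareWeight, Finsupp.weight_single]

theorem squareWeight_le {ℓ : ℕ} (k : Fin (ℓ + 1) →₀ ℕ) :
    squareWeight ℓ k ≤ k.degree * ℓ ^ 2 := by
  rw [squareWeight, Finsupp.weight_eq_sum, Finsupp.degree_eq_sum, Finset.sum_mul]
  exact Finset.sum_le_sum fun i _ =>
    Nat.mul_le_mul_left _ (Nat.pow_le_pow_left (Nat.lt_succ_iff.1 i.2) 2)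

theorem degree_eq_add_add_degree_erase {ℓ : ℕ} (hℓ : ℓ ≠ 0) (k : Fin (ℓ + 1) →₀ ℕ) :
    k.degree = k 0 + k (Fin.last ℓ) + ((k.erase 0).erase (Fin.last ℓ)).degree := by
  have h1 := congrArg Finsupp.degree (Finsupp.erase_add_single 0 k)
  have h2 := congrArg Finsupp.degree (Finsupp.erase_add_single (Fin.last ℓ) (k.erase 0))
  have h3 : (Fin.last ℓ) ≠ 0 := fun h => hℓ (by simpa using congrArg Fin.val h)
  rw [map_add, Finsupp.degree_single] at h1 h2
  rw [Finsupp.erase_ne h3] at h2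
  omega

theorem X_mul_X_mul_X_mul_monomial {ℓ : ℕ} (p q s : Fin (ℓ + 1)) (k : Fin (ℓ + 1) →₀ ℕ) :
    X p * X q * X s * monomial k (1 : ℂ) =
      monomial (Finsupp.single p 1 + Finsupp.single q 1 + Finsupp.single s 1 + k) 1 := by
  simp only [X, monomial_mul, mul_one]

theorem exists_sorted_single_add {ℓ n : ℕ} (hℓ : ℓ ≠ 0) {k : Fin (ℓ + 1) →₀ ℕ}
    (hk : k.degree = n) (hlt : k 0 + k (Fin.last ℓ) < n - 2) :
    ∃ (p q s : Fin (ℓ + 1)) (k' : Fin (ℓ + 1) →₀ ℕ),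
      0 < (p : ℕ) ∧ p ≤ q ∧ q ≤ s ∧ (s : ℕ) < ℓ ∧
      k = Finsupp.single p 1 + Finsupp.single q 1 + Finsupp.single s 1 + k' := by
  set m := (k.erase 0).erase (Fin.last ℓ) with hm
  have hmk : m ≤ k := by
    intro i
    rw [hm, Finsupp.erase_apply, Finsupp.erase_apply]
    split_ifs <;> simp
  have hmi : ∀ i, m i ≠ 0 → 0 < (i : ℕ) ∧ (i : ℕ) < ℓ := by
    intro i hi
    rw [hm, Finsupp.erase_apply, Finsupp.erase_apply] at hi
    split_ifs at hi with h1 h2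
    · exact absurd rfl hi
    · exact absurd rfl hi
    · have h3 : (i : ℕ) ≠ ℓ := fun h => h1 (Fin.ext h)
      have h4 : (i : ℕ) ≠ 0 := fun h => h2 (Fin.ext h)
      have := i.2
      omega
  have hdeg := degree_eq_add_add_degree_erase hℓ k
  rw [← hm] at hdeg
  obtain ⟨p, m₁, hp, hm₁, e₁⟩ := Finsupp.exists_eq_single_add_of_degree_pos (n := 2)
    (by omega : 2 + 1 ≤ m.degree)
  obtain ⟨q, m₂, hq, hm₂, e₂⟩ := Finsupp.exists_eq_single_add_of_degree_pos (n := 1) hm₁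
  obtain ⟨s, m₃, hs, -, e₃⟩ := Finsupp.exists_eq_single_add_of_degree_pos (n := 0) hm₂
  obtain ⟨d, hd⟩ := exists_add_of_le hmk
  have hp' := hmi p hp
  have hq' := hmi q (by rw [e₁, Finsupp.add_apply]; omega)
  have hs' := hmi s (by rw [e₁, e₂, Finsupp.add_apply, Finsupp.add_apply]; omega)
  have e : k = Finsupp.single p 1 + Finsupp.single q 1 + Finsupp.single s 1 + (m₃ + d) := by
    rw [hd, e₁, e₂, e₃]
    abel
  rcases le_total p q with h₁ | h₁ <;> rcases le_total q s with h₂ | h₂ <;>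
    rcases le_total p s with h₃ | h₃
  · exact ⟨p, q, s, m₃ + d, hp'.1, h₁, h₂, hs'.2, e⟩
  · exact ⟨p, q, s, m₃ + d, hp'.1, h₁, h₂, hs'.2, e⟩
  · exact ⟨p, s, q, m₃ + d, hp'.1, h₃, h₂, hq'.2, by rw [e]; abel⟩
  · exact ⟨s, p, q, m₃ + d, hs'.1, h₃, h₁, hq'.2, by rw [e]; abel⟩
  · exact ⟨q, p, s, m₃ + d, hq'.1, h₁, h₃, hs'.2, by rw [e]; abel⟩
  · exact ⟨q, s, p, m₃ + d, hq'.1, h₂, h₃, hp'.2, by rw [e]; abel⟩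
  · exact ⟨s, q, p, m₃ + d, hs'.1, h₂, h₁, hp'.2, by rw [e]; abel⟩
  · exact ⟨s, q, p, m₃ + d, hs'.1, h₂, h₁, hp'.2, by rw [e]; abel⟩

theorem monomial_mem_of_degree_eq {ℓ n : ℕ} (hodd : Odd ℓ)
    {W : Submodule ℂ (MvPolynomial (Fin (ℓ + 1)) ℂ)} (hJ : ∀ p ∈ Jideal ℓ, p ∈ W)
    (hS : ∀ k : Fin (ℓ + 1) →₀ ℕ, k.degree = n → n - 2 ≤ k 0 + k (Fin.last ℓ) →
      monomial k (1 : ℂ) ∈ W)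
    (k : Fin (ℓ + 1) →₀ ℕ) (hk : k.degree = n) : monomial k (1 : ℂ) ∈ W := by
  induction h : n * ℓ ^ 2 - squareWeight ℓ k using Nat.strong_induction_on generalizing k with
  | _ N ih =>
    by_cases hk2 : n - 2 ≤ k 0 + k (Fin.last ℓ)
    · exact hS k hk hk2
    obtain ⟨p, q, s, k', hp, hpq, hqs, hs, rfl⟩ :=
      exists_sorted_single_add hodd.pos.ne' hk (not_le.1 hk2)
    have hpq' : (p : ℕ) ≤ q := hpq
    have hqs' : (q : ℕ) ≤ s := hqs
    have hp1 := Fin.val_sub_one_eq_of_pos hp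
    have hs1 := Fin.val_add_one_eq_of_val_lt hs
    have hlead := leading_mul_mem (W := W) (a := p - 1) (b := q) (c := s + 1)
      (M := monomial k' 1) hodd (Fin.lt_def.2 (by omega)) (Fin.lt_def.2 (by omega)) hJ ?_
    · rwa [sub_add_cancel, add_sub_cancel_right, X_mul_X_mul_X_mul_monomial] at hlead
    · intro x y z hxyz
      rw [hp1, hs1, Nat.sub_add_cancel hp, Nat.add_sub_cancel] at hxyz
      rw [X_mul_X_mul_X_mul_monomial]
      have hdeg : (Finsupp.single x 1 + Finsupp.single y 1 + Finsupp.single z 1 + k').degree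
          = n := by
        rw [← hk]
        simp only [map_add, Finsupp.degree_single]
      refine ih _ ?_ _ hdeg rfl
      have hle := squareWeight_le
        (Finsupp.single x 1 + Finsupp.single y 1 + Finsupp.single z 1 + k')
      rw [hdeg] at hle
      simp only [map_add, squareWeight_single_one] at h hle ⊢
      omega

theorem Finsupp.exists_eq_single_add_single {σ : Type*} {d : σ →₀ ℕ} (hd : d.degree = 2) :
    ∃ i j, d = Finsupp.single i 1 + Finsupp.single j 1 := by
  obtain ⟨i, d₁, -, h₁, rfl⟩ := Finsupp.exists_eq_single_add_of_degree_pos (n := 1) hd.ge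
  obtain ⟨j, d₂, -, -, rfl⟩ := Finsupp.exists_eq_single_add_of_degree_pos (n := 0) h₁
  simp only [map_add, Finsupp.degree_single] at hd
  have h₂ : d₂ = 0 := (Finsupp.degree_eq_zero_iff d₂).1 (by omega)
  exact ⟨i, j, by rw [h₂, add_zero]⟩

/-- The exponent vector of the quadratic monomial `x_i x_j`. -/
noncomputable def pairExponent {σ : Type*} (z : Sym2 σ) : σ →₀ ℕ :=
  Sym2.lift ⟨fun i j => Finsupp.single i 1 + Finsupp.single j 1, fun _ _ => add_comm _ _⟩ z

/-- A parametrization of the exponent vectors of degree `n` with `k_0 + k_ℓ ≥ n - 2`. -/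
noncomputable def concentratedExponent (ℓ n : ℕ) :
    Sym2 (Fin (ℓ + 1)) ⊕ Fin (n - 2) × Sym2 (Fin ℓ) → Fin (ℓ + 1) →₀ ℕ
  | .inl z => Finsupp.single 0 (n - 2) + pairExponent z
  | .inr (t, z) => Finsupp.single 0 (t : ℕ) + Finsupp.single (Fin.last ℓ) (n - 2 - t) +
      pairExponent (z.map Fin.succ)

theorem exists_concentratedExponent_eq {ℓ n : ℕ} (hℓ : ℓ ≠ 0) (hn : 2 ≤ n)
    {k : Fin (ℓ + 1) →₀ ℕ} (hk : k.degree = n) (hk2 : n - 2 ≤ k 0 + k (Fin.last ℓ)) :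
    ∃ x, concentratedExponent ℓ n x = k := by
  have h0 : Fin.last ℓ ≠ 0 := fun h => hℓ (by simpa using congrArg Fin.val h)
  by_cases hk0 : n - 2 ≤ k 0
  · obtain ⟨d, rfl⟩ := exists_add_of_le (Finsupp.single_le_iff.2 hk0)
    rw [map_add, Finsupp.degree_single] at hk
    obtain ⟨i, j, rfl⟩ := Finsupp.exists_eq_single_add_single (d := d) (by omega)
    exact ⟨.inl s(i, j), rfl⟩
  · have hle : Finsupp.single 0 (k 0) + Finsupp.single (Fin.last ℓ) (n - 2 - k 0) ≤ k := by
      intro i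
      rw [Finsupp.add_apply, Finsupp.single_apply, Finsupp.single_apply]
      split_ifs with h1 h2 h2
      · exact absurd (h2.trans h1.symm) h0
      · simp [← h1]
      · rw [← h2]
        omega
      · simp
    obtain ⟨d, hd⟩ := exists_add_of_le hle
    have hdeg := congrArg Finsupp.degree hd
    rw [map_add, map_add, Finsupp.degree_single, Finsupp.degree_single] at hdeg
    have hd0 : d 0 = 0 := by
      have := DFunLike.congr_fun hd 0
      rw [Finsupp.add_apply, Finsupp.add_apply, Finsupp.single_eq_same,
        Finsupp.single_eq_of_ne h0.symm] at this
      omega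
    obtain ⟨i, j, rfl⟩ := Finsupp.exists_eq_single_add_single (d := d) (by omega)
    have hi : i ≠ 0 := by
      rintro rfl
      simp at hd0
    have hj : j ≠ 0 := by
      rintro rfl
      simp at hd0
    obtain ⟨i', rfl⟩ := Fin.exists_succ_eq.2 hi
    obtain ⟨j', rfl⟩ := Fin.exists_succ_eq.2 hj
    exact ⟨.inr (⟨k 0, by omega⟩, s(i', j')), hd.symm⟩

theorem map_homogeneousSubmodule_eq_span {ℓ n : ℕ} (hodd : Odd ℓ) :
    Submodule.map (Ideal.Quotient.mkₐ ℂ (Jideal ℓ)).toLinearMap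
        (homogeneousSubmodule (Fin (ℓ + 1)) ℂ n) =
      Submodule.span ℂ
        {q | ∃ k : Fin (ℓ + 1) →₀ ℕ, (k.sum fun _ e => e) = n ∧
          n - 2 ≤ k 0 + k (Fin.last ℓ) ∧
          q = Ideal.Quotient.mk (Jideal ℓ) (monomial k (1 : ℂ))} := by
  apply le_antisymm
  · rw [Submodule.map_le_iff_le_comap]
    intro p hp
    rw [mem_homogeneousSubmodule] at hp
    rw [p.as_sum]
    refine Submodule.sum_mem _ fun k hk => ?_
    rw [← mul_one (coeff k p), ← smul_eq_mul, ← smul_monomial]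
    refine Submodule.smul_mem _ _ (monomial_mem_of_degree_eq (n := n) hodd ?_ ?_ k ?_)
    · intro q hq
      rw [Submodule.mem_comap]
      have : (Ideal.Quotient.mkₐ ℂ (Jideal ℓ)).toLinearMap q = 0 :=
        Ideal.Quotient.eq_zero_iff_mem.2 hq
      rw [this]
      exact zero_mem _
    · exact fun k hk hk2 => Submodule.subset_span ⟨k, hk, hk2, rfl⟩
    · rw [Finsupp.degree_eq_weight_one]
      exact hp (mem_support_iff.1 hk)
  · rw [Submodule.span_le]
    rintro _ ⟨k, hk, -, rfl⟩
    exact ⟨monomial k 1, isHomogeneous_monomial _ hk, rfl⟩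

/-- For odd `ℓ ≥ 3` and any `n`, the degree-`n` component of `ℂ[x_0,…,x_ℓ]/J` is spanned by the
images of the monomials `x_0^{k_0}⋯x_ℓ^{k_ℓ}` with `Σ k_i = n` and `k_0 + k_ℓ ≥ n − 2`;
in particular, for `n ≥ 2` its dimension is at most `C(ℓ+2,2) + (n−2)·C(ℓ+1,2)`. -/
theorem quotient_component_spanned (ℓ n : ℕ) (hℓ : 3 ≤ ℓ) (hodd : Odd ℓ) :
    Submodule.map (Ideal.Quotient.mkₐ ℂ (Jideal ℓ)).toLinearMap
        (homogeneousSubmodule (Fin (ℓ + 1)) ℂ n) =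
      Submodule.span ℂ
        {q | ∃ k : Fin (ℓ + 1) →₀ ℕ, (k.sum fun _ e => e) = n ∧
          n - 2 ≤ k 0 + k (Fin.last ℓ) ∧
          q = Ideal.Quotient.mk (Jideal ℓ) (monomial k (1 : ℂ))} ∧
    (2 ≤ n →
      Module.finrank ℂ
          (Submodule.map (Ideal.Quotient.mkₐ ℂ (Jideal ℓ)).toLinearMap
            (homogeneousSubmodule (Fin (ℓ + 1)) ℂ n)) ≤
        Nat.choose (ℓ + 2) 2 + (n - 2) * Nat.choose (ℓ + 1) 2) := by
  refine ⟨map_homogeneousSubmodule_eq_span hodd, fun hn => ?_⟩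
  rw [map_homogeneousSubmodule_eq_span hodd]
  set f : Sym2 (Fin (ℓ + 1)) ⊕ Fin (n - 2) × Sym2 (Fin ℓ) →
      MvPolynomial (Fin (ℓ + 1)) ℂ ⧸ Jideal ℓ :=
    fun x => Ideal.Quotient.mk (Jideal ℓ) (monomial (concentratedExponent ℓ n x) 1)
  have hfin : Module.Finite ℂ (Submodule.span ℂ (Set.range f)) :=
    Module.Finite.span_of_finite ℂ (Set.finite_range f)
  calc
    _ ≤ Module.finrank ℂ (Submodule.span ℂ (Set.range f)) := by
      refine Submodule.finrank_mono (Submodule.span_mono ?_)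
      rintro _ ⟨k, hk, hk2, rfl⟩
      obtain ⟨x, rfl⟩ := exists_concentratedExponent_eq (by omega) hn hk hk2
      exact ⟨x, rfl⟩
    _ ≤ _ := finrank_range_le_card f
    _ = _ := by simp [Sym2.card]
end
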